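/- arXiv:2603.02827 — 5 statements merged into one kernel-verified Lean document; each statement's English description precedes it below -/
import Mathlib

section
/- Let G be a biconnected series-parallel simple graph with no transitive edges such that G is at most 2-heavy. Let (s,t) be a separation pair of G whose number of heavy components is maximum among all separation pairs of G, and let G₁ and G₂ be two distinct components of G with respect to (s,t) such that every heavy component of G with respect to (s,t) is G₁ or G₂. For i ∈ {1,2}, let p_i be a path from s to t all of whose vertices belong to G_i of maximum length (number of edges) among all such paths. Then every vertex of G_i not on p_i is adjacent in G to at least one vertex of p_i. -/
open SimpleGraph

variable {V : Type*}

/-- A simple graph is biconnected if it has at least three vertices, is connected,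
and deleting any single vertex leaves it connected. -/
def Biconnected [Fintype V] (G : SimpleGraph V) : Prop :=
  3 ≤ Fintype.card V ∧ G.Connected ∧ ∀ x : V, (G.induce {v | v ≠ x}).Connected

/-- `C` is the vertex set of a connected component of the subgraph of `G` induced by `D`:
`C` is a nonempty subset of `D`, induces a connected graph, and is closed under
adjacency within `D`. -/
def IsCCOf (G : SimpleGraph V) (D C : Set V) : Prop :=
  C.Nonempty ∧ C ⊆ D ∧ (G.induce C).Connected ∧
    ∀ u ∈ C, ∀ w ∈ D, G.Adj u w → w ∈ C

/-- `(s, t)` is a separation pair: `s ≠ t` and `G - s - t` is disconnected. -/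
def SepPair (G : SimpleGraph V) (s t : V) : Prop :=
  s ≠ t ∧ ¬ (G.induce {v | v ≠ s ∧ v ≠ t}).Preconnected

/-- `C` is the set of internal vertices of a component of `G` w.r.t. the separation
pair `(s, t)`, i.e. the vertex set of a connected component of `G - s - t`.
(The component itself is the subgraph induced by `C ∪ {s, t}`.) -/
def IsCompAt (G : SimpleGraph V) (s t : V) (C : Set V) : Prop :=
  IsCCOf G {v | v ≠ s ∧ v ≠ t} C

/-- The component with internal vertices `C` and poles `s, t` is heavy if some internal
vertex is adjacent to neither `s` nor `t`. -/
def Heavy (G : SimpleGraph V) (s t : V) (C : Set V) : Prop :=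
  ∃ v ∈ C, ¬ G.Adj v s ∧ ¬ G.Adj v t

/-- The component with internal vertices `C` and poles `s, t` is light if every internal
vertex is adjacent to `s` or to `t`. -/
def Light (G : SimpleGraph V) (s t : V) (C : Set V) : Prop :=
  ∀ v ∈ C, G.Adj v s ∨ G.Adj v t

/-- `G` has no transitive edges: no edge joins the two vertices of a separation pair. -/
def NoTransitiveEdges (G : SimpleGraph V) : Prop :=
  ∀ s t : V, SepPair G s t → ¬ G.Adj s t

/-- The internal vertices of a walk: its support minus the two endpoints. -/
def interiorSet {G : SimpleGraph V} {u v : V} (w : G.Walk u v) : Set V :=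
  {x | x ∈ w.support ∧ x ≠ u ∧ x ≠ v}

/-- `G` contains a subdivision of `K₄`: four distinct vertices joined pairwise by six
paths that are pairwise internally disjoint and whose internal vertices avoid the four
branch vertices. -/
def ContainsK4Subdivision (G : SimpleGraph V) : Prop :=
  ∃ (a b c d : V) (pab : G.Walk a b) (pac : G.Walk a c) (pad : G.Walk a d)
    (pbc : G.Walk b c) (pbd : G.Walk b d) (pcd : G.Walk c d),
    ([a, b, c, d] : List V).Nodup ∧
    pab.IsPath ∧ pac.IsPath ∧ pad.IsPath ∧
    pbc.IsPath ∧ pbd.IsPath ∧ pcd.IsPath ∧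
    ([interiorSet pab, interiorSet pac, interiorSet pad,
      interiorSet pbc, interiorSet pbd, interiorSet pcd]).Pairwise Disjoint ∧
    ∀ I ∈ [interiorSet pab, interiorSet pac, interiorSet pad,
      interiorSet pbc, interiorSet pbd, interiorSet pcd],
      ∀ x ∈ I, x ∉ ({a, b, c, d} : Set V)

/-- The set of (internal-vertex sets of) heavy components of `G` w.r.t. `(s, t)`. -/
def heavySet (G : SimpleGraph V) (s t : V) : Set (Set V) :=
  {C | IsCompAt G s t C ∧ Heavy G s t C}

namespace SPAux

/-- Walk-reachability inside a set. -/
def Rch (G : SimpleGraph V) (S : Set V) (x y : V) : Prop :=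
  ∃ w : G.Walk x y, ∀ z ∈ w.support, z ∈ S

/-- A nonempty set of vertices inducing a connected graph, in terms of walks. -/
def SConn (G : SimpleGraph V) (S : Set V) : Prop :=
  S.Nonempty ∧ ∀ x ∈ S, ∀ y ∈ S, Rch G S x y

/-- Two vertex sets are joined by an edge. -/
def SAdj (G : SimpleGraph V) (A B : Set V) : Prop :=
  ∃ x ∈ A, ∃ y ∈ B, G.Adj x y

variable {G : SimpleGraph V}

lemma Rch.refl {S : Set V} {x : V} (h : x ∈ S) : Rch G S x x :=
  ⟨Walk.nil, by simpa using h⟩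

lemma Rch.symm {S : Set V} {x y : V} (h : Rch G S x y) : Rch G S y x := by
  obtain ⟨w, hw⟩ := h
  exact ⟨w.reverse, by simpa using hw⟩

lemma Rch.trans {S : Set V} {x y z : V} (h : Rch G S x y) (h' : Rch G S y z) : Rch G S x z := by
  obtain ⟨w, hw⟩ := h
  obtain ⟨w', hw'⟩ := h'
  refine ⟨w.append w', fun u hu => ?_⟩
  rcases (Walk.mem_support_append_iff _ _).1 hu with h | h
  · exact hw u h
  · exact hw' u h

lemma Rch.mono {S T : Set V} {x y : V} (h : Rch G S x y) (hST : S ⊆ T) : Rch G T x y := by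
  obtain ⟨w, hw⟩ := h
  exact ⟨w, fun z hz => hST (hw z hz)⟩

lemma Rch.left {S : Set V} {x y : V} (h : Rch G S x y) : x ∈ S := by
  obtain ⟨w, hw⟩ := h
  exact hw _ w.start_mem_support

lemma Rch.right {S : Set V} {x y : V} (h : Rch G S x y) : y ∈ S := h.symm.left

lemma Rch.adj {S : Set V} {x y : V} (hx : x ∈ S) (hy : y ∈ S) (h : G.Adj x y) : Rch G S x y :=
  ⟨Walk.cons h Walk.nil, by simp [hx, hy]⟩

lemma Rch.exit {S K : Set V} {x y : V} (h : Rch G S x y) (hx : x ∈ K) (hy : y ∉ K) :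
    ∃ u ∈ K, ∃ w, w ∉ K ∧ u ∈ S ∧ w ∈ S ∧ G.Adj u w := by
  obtain ⟨w, hw⟩ := h
  obtain ⟨d, hd, h1, h2⟩ := w.exists_boundary_dart K hx hy
  exact ⟨d.fst, h1, d.snd, h2, hw _ (w.dart_fst_mem_support_of_mem_darts hd),
    hw _ (w.dart_snd_mem_support_of_mem_darts hd), d.adj⟩

lemma rch_iff {S : Set V} {x y : V} (hx : x ∈ S) (hy : y ∈ S) :
    Rch G S x y ↔ (G.induce S).Reachable ⟨x, hx⟩ ⟨y, hy⟩ := by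
  constructor
  · rintro ⟨w, hw⟩
    exact ⟨w.induce S hw⟩
  · rintro ⟨w⟩
    refine ⟨w.map (Embedding.induce S).toHom, ?_⟩
    intro z hz
    erw [Walk.support_map] at hz
    obtain ⟨⟨a, ha⟩, _, rfl⟩ := List.mem_map.1 hz
    exact ha

lemma sconn_of_connected {S : Set V} (h : (G.induce S).Connected) : SConn G S := by
  obtain ⟨x⟩ := h.nonempty
  have hp := h.preconnected
  exact ⟨⟨x.1, x.2⟩, fun x hx y hy => (rch_iff hx hy).2 (hp _ _)⟩

lemma connected_of_sconn {S : Set V} (h : SConn G S) : (G.induce S).Connected := by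
  obtain ⟨⟨x, hx⟩, hp⟩ := h
  have : Nonempty S := ⟨⟨x, hx⟩⟩
  exact ⟨fun a b => (rch_iff a.2 b.2).1 (hp _ a.2 _ b.2)⟩

lemma SConn.singleton (x : V) : SConn G {x} :=
  ⟨⟨x, rfl⟩, by rintro _ rfl _ rfl; exact Rch.refl rfl⟩

/-- The set reachable from a vertex within `S`, connected. -/
lemma sconn_rch {S : Set V} {x : V} (hx : x ∈ S) : SConn G {y | Rch G S x y} := by
  have key : ∀ y, Rch G S x y → Rch G {y | Rch G S x y} x y := by
    rintro y ⟨w, hw⟩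
    classical
    refine ⟨w, fun z hz => ⟨w.takeUntil z hz, fun u hu => hw u ?_⟩⟩
    exact w.support_takeUntil_subset_support hz hu
  exact ⟨⟨x, Rch.refl hx⟩, fun y hy z hz => (key y hy).symm.trans (key z hz)⟩

lemma SAdj.symm {A B : Set V} (h : SAdj G A B) : SAdj G B A := by
  obtain ⟨x, hx, y, hy, h⟩ := h
  exact ⟨y, hy, x, hx, h.symm⟩

lemma SAdj.mono {A B A' B' : Set V} (h : SAdj G A B) (hA : A ⊆ A') (hB : B ⊆ B') :
    SAdj G A' B' := by
  obtain ⟨x, hx, y, hy, h⟩ := h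
  exact ⟨x, hA hx, y, hB hy, h⟩

lemma SConn.union {A B : Set V} (hA : SConn G A) (hB : SConn G B) (h : SAdj G A B) :
    SConn G (A ∪ B) := by
  obtain ⟨x, hx, y, hy, h⟩ := h
  have key : ∀ z ∈ A ∪ B, Rch G (A ∪ B) x z := by
    rintro z (hz | hz)
    · exact (hA.2 x hx z hz).mono Set.subset_union_left
    · exact (Rch.adj (S := A ∪ B) (Or.inl hx) (Or.inr hy) h).trans
        ((hB.2 y hy z hz).mono Set.subset_union_right)
  exact ⟨⟨x, Or.inl hx⟩, fun a ha b hb => (key a ha).symm.trans (key b hb)⟩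

lemma firstHit {s t : V} (p : G.Walk s t) (T : Set V) (h : ∃ x ∈ p.support, x ∈ T) :
    ∃ a ∈ T, ∃ (p1 : G.Walk s a) (p2 : G.Walk a t), p = p1.append p2 ∧
      ∀ z ∈ p1.support, z ∈ T → z = a := by
  induction p with
  | nil =>
    obtain ⟨x, hx, hT⟩ := h
    simp at hx
    subst hx
    exact ⟨_, hT, Walk.nil, Walk.nil, rfl, by simp⟩
  | @cons u v w e q ih =>
    by_cases hu : u ∈ T
    · exact ⟨u, hu, Walk.nil, Walk.cons e q, rfl, by simp⟩
    · obtain ⟨x, hx, hT⟩ := h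
      have hx' : x ∈ q.support := by
        rcases List.mem_cons.1 (by simpa using hx) with h | h
        · exact absurd (h ▸ hT) hu
        · exact h
      obtain ⟨a, ha, p1, p2, rfl, hp⟩ := ih ⟨x, hx', hT⟩
      refine ⟨a, ha, Walk.cons e p1, p2, rfl, ?_⟩
      intro z hz hzT
      rw [Walk.support_cons] at hz
      rcases List.mem_cons.1 hz with rfl | h
      · exact absurd hzT hu
      · exact hp z h hzT

lemma isPath_append {u v w : V} {p : G.Walk u v} {q : G.Walk v w} (hp : p.IsPath) (hq : q.IsPath)
    (h : ∀ z ∈ p.support, z ∈ q.support → z = v) : (p.append q).IsPath := by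
  induction p with
  | nil => simpa using hq
  | cons e r ih =>
    rw [Walk.cons_isPath_iff] at hp
    rw [Walk.cons_append, Walk.cons_isPath_iff]
    refine ⟨ih hp.1 hq (fun z hz => h z (by simp [hz])), ?_⟩
    rw [Walk.mem_support_append_iff]
    rintro (h1 | h1)
    · exact hp.2 h1
    · have := h _ (by simp) h1
      subst this
      exact hp.2 (r.end_mem_support)

lemma append_inter {u v w : V} {p : G.Walk u v} {q : G.Walk v w} (h : (p.append q).IsPath)
    {z : V} (hz : z ∈ p.support) (hz' : z ∈ q.support) : z = v := by
  by_contra hne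
  exact h.ne_of_mem_support_of_append hne hz hz' rfl

lemma exists_path {S : Set V} {x y : V} (h : Rch G S x y) :
    ∃ w : G.Walk x y, w.IsPath ∧ ∀ z ∈ w.support, z ∈ S := by
  classical
  obtain ⟨w, hw⟩ := h
  exact ⟨w.bypass, w.bypass_isPath, fun z hz => hw z (w.support_bypass_subset_support hz)⟩

lemma tripod {S : Set V} (hS : SConn G S) {x y z : V} (hx : x ∈ S) (hy : y ∈ S) (hz : z ∈ S) :
    ∃ (c : V) (p : G.Walk c x) (q : G.Walk c y) (r : G.Walk c z),
      p.IsPath ∧ q.IsPath ∧ r.IsPath ∧ (∀ u ∈ p.support, u ∈ S) ∧ (∀ u ∈ q.support, u ∈ S) ∧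
      (∀ u ∈ r.support, u ∈ S) ∧ (∀ u ∈ p.support, u ∈ q.support → u = c) ∧
      (∀ u ∈ p.support, u ∈ r.support → u = c) ∧ (∀ u ∈ q.support, u ∈ r.support → u = c) := by
  obtain ⟨P, hP, hPS⟩ := exists_path (hS.2 x hx y hy)
  obtain ⟨W, hW, hWS⟩ := exists_path (hS.2 z hz x hx)
  obtain ⟨c, hc, w1, w2, rfl, hfirst⟩ :=
    firstHit W {u | u ∈ P.support} ⟨x, W.end_mem_support, P.start_mem_support⟩
  obtain ⟨P1, P2, h1, h2, rfl⟩ := hP.mem_support_iff_exists_append.1 hc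
  refine ⟨c, P1.reverse, P2, w1.reverse, h1.reverse, h2, hW.of_append_left.reverse, ?_, ?_, ?_,
    ?_, ?_, ?_⟩
  · intro u hu
    exact hPS u (by simp at hu; simp [hu])
  · intro u hu
    exact hPS u (by simp [hu])
  · intro u hu
    exact hWS u (by simp at hu; simp [hu])
  · intro u hu hu'
    exact append_inter hP (by simpa using hu) hu'
  · intro u hu hu'
    exact hfirst u (by simpa using hu') (by simp at hu; simp [hu])
  · intro u hu hu'
    exact hfirst u (by simpa using hu') (by simp [hu])

lemma link {c x d y : V} {p : G.Walk c x} {q : G.Walk d y} (hp : p.IsPath) (hq : q.IsPath)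
    (h : G.Adj x y) (hd : ∀ u ∈ p.support, u ∉ q.support) :
    ∃ w : G.Walk c d, w.IsPath ∧
      interiorSet w ⊆ {u | u ∈ p.support ∧ u ≠ c} ∪ {u | u ∈ q.support ∧ u ≠ d} := by
  refine ⟨p.append (Walk.cons h q.reverse), isPath_append hp ?_ ?_, ?_⟩
  · rw [Walk.cons_isPath_iff]
    exact ⟨hq.reverse, by simpa using hd x p.end_mem_support⟩
  · intro z hz hz'
    simp at hz'
    rcases hz' with rfl | h'
    · rfl
    · exact absurd h' (hd z hz)
  · rintro u ⟨hu, h1, h2⟩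
    simp at hu
    rcases hu with hu | rfl | hu
    · exact Or.inl ⟨hu, h1⟩
    · exact Or.inl ⟨p.end_mem_support, h1⟩
    · exact Or.inr ⟨hu, h2⟩

lemma disj_key (I J I' J' : Set V) (h1 : I ⊆ I') (h2 : J ⊆ J')
    (h3 : ∀ u, u ∈ I' → u ∈ J' → False) : Disjoint I J :=
  Set.disjoint_left.2 fun u hu hu' => h3 u (h1 hu) (h2 hu')

set_option maxHeartbeats 4000000 in
lemma k4_of_minor {A B C D : Set V} (hA : SConn G A) (hB : SConn G B) (hC : SConn G C)
    (hD : SConn G D) (dAB : Disjoint A B) (dAC : Disjoint A C) (dAD : Disjoint A D)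
    (dBC : Disjoint B C) (dBD : Disjoint B D) (dCD : Disjoint C D)
    (eAB : SAdj G A B) (eAC : SAdj G A C) (eAD : SAdj G A D)
    (eBC : SAdj G B C) (eBD : SAdj G B D) (eCD : SAdj G C D) : ContainsK4Subdivision G := by
  rw [Set.disjoint_left] at dAB dAC dAD dBC dBD dCD
  obtain ⟨ab, hab, ba, hba, eab⟩ := eAB
  obtain ⟨ac, hac, ca, hca, eac⟩ := eAC
  obtain ⟨ad, had, da, hda, ead⟩ := eAD
  obtain ⟨bc, hbc, cb, hcb, ebc⟩ := eBC
  obtain ⟨bd, hbd, db, hdb, ebd⟩ := eBD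
  obtain ⟨cd, hcd, dc, hdc, ecd⟩ := eCD
  obtain ⟨a, a1, a2, a3, pa1, pa2, pa3, sa1, sa2, sa3, ia12, ia13, ia23⟩ := tripod hA hab hac had
  obtain ⟨b, b1, b2, b3, pb1, pb2, pb3, sb1, sb2, sb3, ib12, ib13, ib23⟩ := tripod hB hba hbc hbd
  obtain ⟨c, c1, c2, c3, pc1, pc2, pc3, sc1, sc2, sc3, ic12, ic13, ic23⟩ := tripod hC hca hcb hcd
  obtain ⟨d, d1, d2, d3, pd1, pd2, pd3, sd1, sd2, sd3, id12, id13, id23⟩ := tripod hD hda hdb hdc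
  have haA : a ∈ A := sa1 _ a1.start_mem_support
  have hbB : b ∈ B := sb1 _ b1.start_mem_support
  have hcC : c ∈ C := sc1 _ c1.start_mem_support
  have hdD : d ∈ D := sd1 _ d1.start_mem_support
  obtain ⟨wab, pab, iab⟩ := link pa1 pb1 eab (fun u h h' => dAB (sa1 u h) (sb1 u h'))
  obtain ⟨wac, pac, iac⟩ := link pa2 pc1 eac (fun u h h' => dAC (sa2 u h) (sc1 u h'))
  obtain ⟨wad, pad, iad⟩ := link pa3 pd1 ead (fun u h h' => dAD (sa3 u h) (sd1 u h'))
  obtain ⟨wbc, pbc, ibc⟩ := link pb2 pc2 ebc (fun u h h' => dBC (sb2 u h) (sc2 u h'))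
  obtain ⟨wbd, pbd, ibd⟩ := link pb3 pd2 ebd (fun u h h' => dBD (sb3 u h) (sd2 u h'))
  obtain ⟨wcd, pcd, icd⟩ := link pc3 pd3 ecd (fun u h h' => dCD (sc3 u h) (sd3 u h'))
  refine ⟨a, b, c, d, wab, wac, wad, wbc, wbd, wcd, ?_, pab, pac, pad, pbc, pbd, pcd, ?_, ?_⟩
  · simp only [List.nodup_cons, List.mem_cons, List.not_mem_nil, or_false, not_or, not_false_eq_true,
      List.nodup_nil, and_true]
    refine ⟨⟨?_, ?_, ?_⟩, ⟨?_, ?_⟩, ?_⟩ <;> rintro rfl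
    · exact dAB haA hbB
    · exact dAC haA hcC
    · exact dAD haA hdD
    · exact dBC hbB hcC
    · exact dBD hbB hdD
    · exact dCD hcC hdD
  · simp only [List.pairwise_cons, List.mem_cons, List.not_mem_nil, or_false, forall_eq_or_imp,
      forall_eq, List.Pairwise.nil, and_true, IsEmpty.forall_iff, implies_true]
    refine ⟨⟨?_, ?_, ?_, ?_, ?_⟩, ⟨?_, ?_, ?_, ?_⟩, ⟨?_, ?_, ?_⟩, ⟨?_, ?_⟩, ?_⟩
    · exact disj_key _ _ _ _ iab iac (by rintro u (⟨h1, h2⟩ | ⟨h1, h2⟩) (⟨h3, h4⟩ | ⟨h3, h4⟩) <;> clear iab iac iad ibc ibd icd <;> grind)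
    · exact disj_key _ _ _ _ iab iad (by rintro u (⟨h1, h2⟩ | ⟨h1, h2⟩) (⟨h3, h4⟩ | ⟨h3, h4⟩) <;> clear iab iac iad ibc ibd icd <;> grind)
    · exact disj_key _ _ _ _ iab ibc (by rintro u (⟨h1, h2⟩ | ⟨h1, h2⟩) (⟨h3, h4⟩ | ⟨h3, h4⟩) <;> clear iab iac iad ibc ibd icd <;> grind)
    · exact disj_key _ _ _ _ iab ibd (by rintro u (⟨h1, h2⟩ | ⟨h1, h2⟩) (⟨h3, h4⟩ | ⟨h3, h4⟩) <;> clear iab iac iad ibc ibd icd <;> grind)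
    · exact disj_key _ _ _ _ iab icd (by rintro u (⟨h1, h2⟩ | ⟨h1, h2⟩) (⟨h3, h4⟩ | ⟨h3, h4⟩) <;> clear iab iac iad ibc ibd icd <;> grind)
    · exact disj_key _ _ _ _ iac iad (by rintro u (⟨h1, h2⟩ | ⟨h1, h2⟩) (⟨h3, h4⟩ | ⟨h3, h4⟩) <;> clear iab iac iad ibc ibd icd <;> grind)
    · exact disj_key _ _ _ _ iac ibc (by rintro u (⟨h1, h2⟩ | ⟨h1, h2⟩) (⟨h3, h4⟩ | ⟨h3, h4⟩) <;> clear iab iac iad ibc ibd icd <;> grind)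
    · exact disj_key _ _ _ _ iac ibd (by rintro u (⟨h1, h2⟩ | ⟨h1, h2⟩) (⟨h3, h4⟩ | ⟨h3, h4⟩) <;> clear iab iac iad ibc ibd icd <;> grind)
    · exact disj_key _ _ _ _ iac icd (by rintro u (⟨h1, h2⟩ | ⟨h1, h2⟩) (⟨h3, h4⟩ | ⟨h3, h4⟩) <;> clear iab iac iad ibc ibd icd <;> grind)
    · exact disj_key _ _ _ _ iad ibc (by rintro u (⟨h1, h2⟩ | ⟨h1, h2⟩) (⟨h3, h4⟩ | ⟨h3, h4⟩) <;> clear iab iac iad ibc ibd icd <;> grind)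
    · exact disj_key _ _ _ _ iad ibd (by rintro u (⟨h1, h2⟩ | ⟨h1, h2⟩) (⟨h3, h4⟩ | ⟨h3, h4⟩) <;> clear iab iac iad ibc ibd icd <;> grind)
    · exact disj_key _ _ _ _ iad icd (by rintro u (⟨h1, h2⟩ | ⟨h1, h2⟩) (⟨h3, h4⟩ | ⟨h3, h4⟩) <;> clear iab iac iad ibc ibd icd <;> grind)
    · exact disj_key _ _ _ _ ibc ibd (by rintro u (⟨h1, h2⟩ | ⟨h1, h2⟩) (⟨h3, h4⟩ | ⟨h3, h4⟩) <;> clear iab iac iad ibc ibd icd <;> grind)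
    · exact disj_key _ _ _ _ ibc icd (by rintro u (⟨h1, h2⟩ | ⟨h1, h2⟩) (⟨h3, h4⟩ | ⟨h3, h4⟩) <;> clear iab iac iad ibc ibd icd <;> grind)
    · exact disj_key _ _ _ _ ibd icd (by rintro u (⟨h1, h2⟩ | ⟨h1, h2⟩) (⟨h3, h4⟩ | ⟨h3, h4⟩) <;> clear iab iac iad ibc ibd icd <;> grind)
  · simp only [List.mem_cons, List.not_mem_nil, or_false, forall_eq_or_imp, forall_eq,
      Set.mem_insert_iff, Set.mem_singleton_iff, not_or]
    refine ⟨?_, ?_, ?_, ?_, ?_, ?_⟩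
    · intro u hu; rcases iab hu with ⟨h1, h2⟩ | ⟨h1, h2⟩ <;> clear iab iac iad ibc ibd icd <;> grind
    · intro u hu; rcases iac hu with ⟨h1, h2⟩ | ⟨h1, h2⟩ <;> clear iab iac iad ibc ibd icd <;> grind
    · intro u hu; rcases iad hu with ⟨h1, h2⟩ | ⟨h1, h2⟩ <;> clear iab iac iad ibc ibd icd <;> grind
    · intro u hu; rcases ibc hu with ⟨h1, h2⟩ | ⟨h1, h2⟩ <;> clear iab iac iad ibc ibd icd <;> grind
    · intro u hu; rcases ibd hu with ⟨h1, h2⟩ | ⟨h1, h2⟩ <;> clear iab iac iad ibc ibd icd <;> grind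
    · intro u hu; rcases icd hu with ⟨h1, h2⟩ | ⟨h1, h2⟩ <;> clear iab iac iad ibc ibd icd <;> grind

lemma penult {u v : V} (q : G.Walk u v) (hq : q.IsPath) (h : u ≠ v) :
    ∃ y ∈ q.support, y ≠ v ∧ G.Adj y v := by
  have key : ∀ {v u : V} (q : G.Walk v u), q.IsPath → v ≠ u →
      ∃ y ∈ q.support, y ≠ v ∧ G.Adj v y := by
    intro v u q hq h
    cases q with
    | nil => exact absurd rfl h
    | cons e r =>
      exact ⟨_, by simp, e.ne', e⟩
  obtain ⟨y, h1, h2, h3⟩ := key q.reverse hq.reverse h.symm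
  exact ⟨y, by simpa using h1, h2, h3.symm⟩

lemma sconn_dropEnd {u v : V} (q : G.Walk u v) (hq : q.IsPath) (h : u ≠ v) :
    SConn G {x | x ∈ q.support ∧ x ≠ v} := by
  classical
  have key : ∀ x, x ∈ {x | x ∈ q.support ∧ x ≠ v} →
      Rch G {x | x ∈ q.support ∧ x ≠ v} u x := by
    rintro x ⟨hx, hxv⟩
    refine ⟨q.takeUntil x hx, fun z hz => ⟨q.support_takeUntil_subset_support hx hz, ?_⟩⟩
    rintro rfl
    exact Walk.endpoint_notMem_support_takeUntil hq hx hxv.symm hz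
  exact ⟨⟨u, q.start_mem_support, h⟩, fun a ha b hb => (key a ha).symm.trans (key b hb)⟩

lemma sconn_ext {s a : V} (q : G.Walk s a) (hq : q.IsPath) {Q : Set V} (hQ : SConn G Q)
    (hs : ∃ c ∈ Q, G.Adj c s) :
    SConn G (Q ∪ {x | x ∈ q.support ∧ x ≠ a}) ∧
      ∃ y ∈ Q ∪ {x | x ∈ q.support ∧ x ≠ a}, G.Adj y a := by
  obtain ⟨c, hc, hcs⟩ := hs
  by_cases h : s = a
  · subst h
    have : q = Walk.nil := (Walk.isPath_iff_nil.1 hq).eq_nil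
    subst this
    have : {x | x ∈ (Walk.nil : G.Walk s s).support ∧ x ≠ s} = (∅ : Set V) := by
      ext x; simp
    rw [this, Set.union_empty]
    exact ⟨hQ, c, hc, hcs⟩
  · obtain ⟨y, hy, hya, hadj⟩ := penult q hq h
    exact ⟨hQ.union (sconn_dropEnd q hq h) ⟨c, hc, s, ⟨q.start_mem_support, h⟩, hcs⟩,
      y, Or.inr ⟨hy, hya⟩, hadj⟩

lemma sconn_J {s a b t : V} (p1 : G.Walk s a) (p3 : G.Walk b t) (h1 : p1.IsPath) (h3 : p3.IsPath)
    {Q : Set V} (hQ : SConn G Q) (hs : ∃ c ∈ Q, G.Adj c s) (ht : ∃ c ∈ Q, G.Adj c t) :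
    ∃ J : Set V, J = Q ∪ {x | x ∈ p1.support ∧ x ≠ a} ∪ {x | x ∈ p3.support ∧ x ≠ b} ∧
      SConn G J ∧ (∃ y ∈ J, G.Adj y a) ∧ (∃ y ∈ J, G.Adj y b) := by
  obtain ⟨hA, y, hy, hya⟩ := sconn_ext p1 h1 hQ hs
  obtain ⟨c, hc, hct⟩ := ht
  obtain ⟨hB, z, hz, hzb⟩ := sconn_ext p3.reverse h3.reverse hA ⟨c, Or.inl hc, hct⟩
  simp only [Walk.support_reverse, List.mem_reverse] at hB hz
  exact ⟨_, rfl, hB, ⟨y, Or.inl hy, hya⟩, ⟨z, hz, hzb⟩⟩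

/-- Bookkeeping for a path split in three pieces. -/
lemma split_facts {s t a b x : V} {p1 : G.Walk s a} {e : G.Adj a x} {r : G.Walk x b}
    {p3 : G.Walk b t} (hp : (p1.append ((Walk.cons e r).append p3)).IsPath) :
    p1.IsPath ∧ r.IsPath ∧ p3.IsPath ∧ a ∉ r.support ∧ (∀ z ∈ p1.support, z ∉ r.support) ∧
      (∀ z ∈ p1.support, z ∉ p3.support) ∧ (∀ z ∈ r.support, z ∈ p3.support → z = b) := by
  have h23 := hp.of_append_right
  have h2 := h23.of_append_left
  rw [Walk.cons_isPath_iff] at h2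
  have har := h2.2
  have h13 : ∀ z ∈ p1.support, z ∉ p3.support := by
    intro z hz hz'
    have : z = a := append_inter hp hz (by simp [hz'])
    subst this
    have : z = b := append_inter h23 (by simp) hz'
    subst this
    exact har r.end_mem_support
  refine ⟨hp.of_append_left, h2.1, h23.of_append_right, har, ?_, h13, ?_⟩
  · intro z hz hz'
    have : z = a := append_inter hp hz (by simp [hz'])
    subst this
    exact har hz'
  · intro z hz hz'
    exact append_inter h23 (by simp [hz]) hz'

lemma sep (hK4 : ¬ ContainsK4Subdivision G) {s t a b x : V} (p1 : G.Walk s a) (e : G.Adj a x)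
    (r : G.Walk x b) (p3 : G.Walk b t) (hp : (p1.append ((Walk.cons e r).append p3)).IsPath)
    (hxb : x ≠ b) {Q : Set V} (hQ : SConn G Q) (hs : ∃ c ∈ Q, G.Adj c s)
    (ht : ∃ c ∈ Q, G.Adj c t)
    (hQp : ∀ z ∈ (p1.append ((Walk.cons e r).append p3)).support, z ∉ Q)
    {K : Set V} (hK : SConn G ({a} ∪ K)) (hKQ : ∀ z ∈ K, z ∉ Q)
    (hKp : ∀ z ∈ (p1.append ((Walk.cons e r).append p3)).support, z ∉ K)
    (hKn : ∀ k ∈ K, ∀ y, G.Adj k y → y ∈ K ∨ y = a ∨ y = b)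
    (hKb : SAdj G ({a} ∪ K) {b}) {u : V} (hu : u ∈ Q) :
    ¬ Rch G {z | z ≠ a ∧ z ≠ b} x u := by
  intro hR
  obtain ⟨h1, hr, h3, har, h1r, h13, hr3⟩ := split_facts hp
  simp only [Walk.mem_support_append_iff, Walk.support_cons, List.mem_cons] at hQp hKp
  obtain ⟨J, hJdef, hJ, ⟨ja, hja, hja'⟩, ⟨jb, hjb, hjb'⟩⟩ := sconn_J p1 p3 h1 h3 hQ hs ht
  set I : Set V := {z | z ∈ r.support ∧ z ≠ b} with hI
  have hIc : SConn G I := sconn_dropEnd r hr hxb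
  obtain ⟨i, hi, hib, hiadj⟩ := penult r hr hxb
  have hb : b ∈ r.support := r.end_mem_support
  have hb3 : b ∈ p3.support := p3.start_mem_support
  have ha1 : a ∈ p1.support := p1.end_mem_support
  set S : Set V := {z | z ≠ a ∧ z ≠ b ∧ z ∉ I ∧ z ∉ K} with hS
  have hJS : J ⊆ S := by
    intro z hz
    rw [hJdef] at hz
    rcases hz with (hz | ⟨hz, hza⟩) | ⟨hz, hzb⟩
    · refine ⟨?_, ?_, ?_, ?_⟩
      · rintro rfl
        exact hQp _ (Or.inl ha1) hz
      · rintro rfl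
        exact hQp _ (Or.inr (Or.inr hb3)) hz
      · intro h
        exact hQp _ (Or.inr (Or.inl (Or.inr h.1))) hz
      · intro h
        exact hKQ _ h hz
    · refine ⟨hza, ?_, ?_, ?_⟩
      · rintro rfl
        exact h13 _ hz hb3
      · intro h
        exact h1r _ hz h.1
      · exact hKp _ (Or.inl hz)
    · refine ⟨?_, hzb, ?_, ?_⟩
      · rintro rfl
        exact h13 _ ha1 hz
      · intro h
        exact hzb (hr3 _ h.1 hz)
      · exact hKp _ (Or.inr (Or.inr hz))
  have huJ : u ∈ J := by rw [hJdef]; exact Or.inl (Or.inl hu)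
  have huS : u ∈ S := hJS huJ
  set J' : Set V := {y | Rch G S u y} with hJ'
  have hJ'c : SConn G J' := sconn_rch huS
  have hJJ' : J ⊆ J' := fun z hz => (hJ.2 u huJ z hz).mono hJS
  have hJ'S : J' ⊆ S := fun z hz => Rch.right hz
  have hxI : x ∈ I := ⟨r.start_mem_support, hxb⟩
  obtain ⟨y, hy, z, hz, -, hz2, hyz⟩ := hR.symm.exit (K := J') (hJJ' huJ)
    (fun h => (hJ'S h).2.2.1 hxI)
  have hyS := hJ'S hy
  have hzI : z ∈ I := by
    by_contra hzI
    by_cases hzK : z ∈ K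
    · rcases hKn z hzK y hyz.symm with h | h | h
      · exact hyS.2.2.2 h
      · exact hyS.1 h
      · exact hyS.2.1 h
    · have hzS : z ∈ S := ⟨hz2.1, hz2.2, hzI, hzK⟩
      exact hz (Rch.trans hy (Rch.adj hyS hzS hyz))
  refine hK4 (k4_of_minor hK (SConn.singleton b) hIc hJ'c ?_ ?_ ?_ ?_ ?_ ?_ hKb ?_ ?_ ?_ ?_ ?_)
  · rw [Set.disjoint_left]
    rintro w hw rfl
    rcases hw with rfl | hw
    · exact har hb
    · exact hKp _ (Or.inr (Or.inr hb3)) hw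
  · rw [Set.disjoint_left]
    rintro w hw hwI
    rcases hw with rfl | hw
    · exact har hwI.1
    · exact hKp _ (Or.inr (Or.inl (Or.inr hwI.1))) hw
  · rw [Set.disjoint_left]
    rintro w hw hwJ
    rcases hw with rfl | hw
    · exact (hJ'S hwJ).1 rfl
    · exact (hJ'S hwJ).2.2.2 hw
  · rw [Set.disjoint_left]
    rintro w rfl hw
    exact hw.2 rfl
  · rw [Set.disjoint_left]
    rintro w rfl hw
    exact (hJ'S hw).2.1 rfl
  · rw [Set.disjoint_left]
    rintro w hwI hw
    exact (hJ'S hw).2.2.1 hwI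
  · exact ⟨a, Or.inl rfl, x, hxI, e⟩
  · exact ⟨a, Or.inl rfl, ja, hJJ' hja, hja'.symm⟩
  · exact ⟨b, rfl, i, ⟨hi, hib⟩, hiadj.symm⟩
  · exact ⟨b, rfl, jb, hJJ' hjb, hjb'.symm⟩
  · exact ⟨z, hzI, y, hy, hyz.symm⟩

/-- A connected set attached at both ends of a subpath is not attached to its interior. -/
lemma no_third (hK4 : ¬ ContainsK4Subdivision G) {s t a b x : V} (p1 : G.Walk s a) (e : G.Adj a x)
    (r : G.Walk x b) (p3 : G.Walk b t) (hp : (p1.append ((Walk.cons e r).append p3)).IsPath)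
    {Q : Set V} (hQ : SConn G Q) (hs : ∃ c ∈ Q, G.Adj c s)
    (ht : ∃ c ∈ Q, G.Adj c t)
    (hQp : ∀ z ∈ (p1.append ((Walk.cons e r).append p3)).support, z ∉ Q)
    {K : Set V} (hK : SConn G K) (hKQ : ∀ z ∈ K, z ∉ Q)
    (hKp : ∀ z ∈ (p1.append ((Walk.cons e r).append p3)).support, z ∉ K)
    (hKa : ∃ k ∈ K, G.Adj k a) (hKb : ∃ k ∈ K, G.Adj k b) :
    ∀ z ∈ r.support, z ≠ b → ∀ k ∈ K, ¬ G.Adj k z := by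
  intro z hz hzb k hk hkz
  obtain ⟨h1, hr, h3, har, h1r, h13, hr3⟩ := split_facts hp
  simp only [Walk.mem_support_append_iff, Walk.support_cons, List.mem_cons] at hQp hKp
  obtain ⟨J, hJdef, hJ, ⟨ja, hja, hja'⟩, ⟨jb, hjb, hjb'⟩⟩ := sconn_J p1 p3 h1 h3 hQ hs ht
  have hxb : x ≠ b := by
    rintro rfl
    have : r = Walk.nil := (Walk.isPath_iff_nil.1 hr).eq_nil
    subst this
    simp at hz
    exact hzb hz
  set I : Set V := {z | z ∈ r.support ∧ z ≠ b} with hI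
  have hIc : SConn G I := sconn_dropEnd r hr hxb
  obtain ⟨i, hi, hib, hiadj⟩ := penult r hr hxb
  have hb : b ∈ r.support := r.end_mem_support
  have hb3 : b ∈ p3.support := p3.start_mem_support
  have ha1 : a ∈ p1.support := p1.end_mem_support
  obtain ⟨ka, hka, hka'⟩ := hKa
  obtain ⟨kb, hkb, hkb'⟩ := hKb
  have hA : SConn G ({a} ∪ J) := (SConn.singleton a).union hJ ⟨a, rfl, ja, hja, hja'.symm⟩
  refine hK4 (k4_of_minor hA (SConn.singleton b) hIc hK ?_ ?_ ?_ ?_ ?_ ?_ ?_ ?_ ?_ ?_ ?_ ?_)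
  · rw [Set.disjoint_left]
    rintro w hw rfl
    rw [hJdef] at hw
    rcases hw with rfl | (hw | hw) | hw
    · exact har hb
    · exact hQp _ (Or.inr (Or.inr hb3)) hw
    · exact h13 _ hw.1 hb3
    · exact hw.2 rfl
  · rw [Set.disjoint_left]
    rintro w hw hwI
    rw [hJdef] at hw
    rcases hw with rfl | (hw | hw) | hw
    · exact har hwI.1
    · exact hQp _ (Or.inr (Or.inl (Or.inr hwI.1))) hw
    · exact h1r _ hw.1 hwI.1
    · exact hw.2 (hr3 _ hwI.1 hw.1)
  · rw [Set.disjoint_left]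
    rintro w hw hwK
    rw [hJdef] at hw
    rcases hw with rfl | (hw | hw) | hw
    · exact hKp _ (Or.inl ha1) hwK
    · exact hKQ _ hwK hw
    · exact hKp _ (Or.inl hw.1) hwK
    · exact hKp _ (Or.inr (Or.inr hw.1)) hwK
  · rw [Set.disjoint_left]
    rintro w rfl hw
    exact hw.2 rfl
  · rw [Set.disjoint_left]
    rintro w rfl hw
    exact hKp _ (Or.inr (Or.inr hb3)) hw
  · rw [Set.disjoint_left]
    rintro w hwI hw
    exact hKp _ (Or.inr (Or.inl (Or.inr hwI.1))) hw
  · exact ⟨jb, Or.inr hjb, b, rfl, hjb'⟩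
  · exact ⟨a, Or.inl rfl, x, ⟨r.start_mem_support, hxb⟩, e⟩
  · exact ⟨a, Or.inl rfl, ka, hka, hka'.symm⟩
  · exact ⟨b, rfl, i, ⟨hi, hib⟩, hiadj.symm⟩
  · exact ⟨b, rfl, kb, hkb, hkb'.symm⟩
  · exact ⟨z, ⟨hz, hzb⟩, k, hk, hkz.symm⟩

lemma fan {K : Set V} {a b : V} (hab : a ≠ b) (haK : a ∉ K) (hbK : b ∉ K) (hK : SConn G K)
    (hKa : ∃ k ∈ K, G.Adj k a) (hKb : ∃ k ∈ K, G.Adj k b)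
    (hKn : ∀ k ∈ K, ∀ y, G.Adj k y → y ∈ K ∨ y = a ∨ y = b)
    (hbi : ∀ c x y : V, x ≠ c → y ≠ c → Rch G {z | z ≠ c} x y) {v : V} (hv : v ∈ K) :
    ∃ q : G.Walk a b, q.IsPath ∧ (∀ z ∈ q.support, z ∈ K ∨ z = a ∨ z = b) ∧ v ∈ q.support := by
  by_contra hcon
  set X : Set V := {v | v ∈ K ∧ ∃ q : G.Walk a b, q.IsPath ∧
    (∀ z ∈ q.support, z ∈ K ∨ z = a ∨ z = b) ∧ v ∈ q.support} with hX
  obtain ⟨ka, hka, hka'⟩ := hKa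
  obtain ⟨kb, hkb, hkb'⟩ := hKb
  have hkaX : ka ∈ X := by
    refine ⟨hka, ?_⟩
    obtain ⟨w, hw, hwK⟩ := exists_path (hK.2 ka hka kb hkb)
    refine ⟨Walk.cons hka'.symm (w.append (Walk.cons hkb' Walk.nil)), ?_, ?_, by simp⟩
    · rw [Walk.cons_isPath_iff]
      constructor
      · apply isPath_append hw
        · rw [Walk.cons_isPath_iff]
          exact ⟨Walk.IsPath.nil, by simpa using hkb'.ne⟩
        · intro z hz hz'
          simp at hz'
          rcases hz' with rfl | rfl
          · rfl
          · exact absurd (hwK _ hz) hbK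
      · simp
        exact ⟨fun h => haK (hwK _ h), fun h => haK (h ▸ hkb), hab⟩
    · intro z hz
      simp at hz
      rcases hz with rfl | h | rfl | rfl
      · exact Or.inr (Or.inl rfl)
      · exact Or.inl (hwK _ h)
      · exact Or.inl hkb
      · exact Or.inr (Or.inr rfl)
  have hvX : v ∉ X := fun h => hcon h.2
  obtain ⟨x, ⟨hxK, q, hq, hqK, hxq⟩, y, hyX, -, hyK, hxy⟩ := (hK.2 ka hka v hv).exit hkaX hvX
  have hyq : y ∉ q.support := fun h => hyX ⟨hyK, q, hq, hqK, h⟩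
  have hxa : a ≠ x := by rintro rfl; exact haK hxK
  obtain ⟨W, hW, hWx⟩ := exists_path (hbi x y a hxy.ne' hxa)
  obtain ⟨c, hcT, w, w2, rfl, hfirst⟩ := firstHit W {z | z ∉ K ∨ z ∈ q.support}
    ⟨a, W.end_mem_support, Or.inl haK⟩
  have hw := hW.of_append_left
  have hyc : y ≠ c := by
    rintro rfl
    rcases hcT with h | h
    · exact h hyK
    · exact hyq h
  have hcx : c ≠ x := hWx c (by simp)
  have hwx : x ∉ w.support := fun h => hWx x (by simp [h]) rfl
  have hwK : ∀ z ∈ w.support, z ≠ c → z ∈ K ∧ z ∉ q.support := by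
    intro z hz hzc
    constructor
    · by_contra h
      exact hzc (hfirst z hz (Or.inl h))
    · intro h
      exact hzc (hfirst z hz (Or.inr h))
  have hcq : c ∈ q.support := by
    obtain ⟨d, hd, hdc, hadj⟩ := penult w hw hyc
    rcases hKn d (hwK d hd hdc).1 c hadj with h | rfl | rfl
    · rcases hcT with h' | h'
      · exact absurd h h'
      · exact h'
    · exact q.start_mem_support
    · exact q.end_mem_support
  have hwK' : ∀ z ∈ w.support, z ∈ K ∨ z = a ∨ z = b := by
    intro z hz
    by_cases hzc : z = c
    · exact hzc ▸ hqK c hcq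
    · exact Or.inl (hwK z hz hzc).1
  obtain ⟨q1, q2, hq1, hq2, rfl⟩ := hq.mem_support_iff_exists_append.1 hxq
  rcases (Walk.mem_support_append_iff _ _).1 hcq with hc | hc
  · obtain ⟨r1, r2, hr1, hr2, rfl⟩ := hq1.mem_support_iff_exists_append.1 hc
    apply hyX
    refine ⟨hyK, r1.append (w.reverse.append (Walk.cons hxy.symm q2)), ?_, ?_, by simp⟩
    · apply isPath_append hr1
      · apply isPath_append hw.reverse
        · rw [Walk.cons_isPath_iff]
          exact ⟨hq2, fun h => hyq (by simp [h])⟩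
        · intro z hz hz'
          simp only [Walk.support_reverse, List.mem_reverse] at hz
          simp only [Walk.support_cons, List.mem_cons] at hz'
          rcases hz' with h | h
          · exact h
          · exfalso
            by_cases hzc : z = c
            · subst hzc
              exact hcx (append_inter hq hc h)
            · exact (hwK z hz hzc).2 (by simp [h])
      · intro z hz hz'
        simp only [Walk.mem_support_append_iff, Walk.support_reverse, List.mem_reverse,
          Walk.support_cons, List.mem_cons] at hz'
        by_contra hzc
        rcases hz' with h | rfl | h
        · exact (hwK z h hzc).2 (by simp [hz])
        · exact hyq (by simp [hz])
        · have hzx : z = x := append_inter hq (by simp [hz]) h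
          subst hzx
          exact hzc (append_inter hq1 hz r2.end_mem_support)
    · intro z hz
      simp only [Walk.mem_support_append_iff, Walk.support_reverse, List.mem_reverse,
        Walk.support_cons, List.mem_cons] at hz
      rcases hz with h | h | rfl | h
      · exact hqK z (by simp [h])
      · exact hwK' z h
      · exact Or.inl hyK
      · exact hqK z (by simp [h])
  · obtain ⟨r1, r2, hr1, hr2, rfl⟩ := hq2.mem_support_iff_exists_append.1 hc
    apply hyX
    refine ⟨hyK, q1.append (Walk.cons hxy (w.append r2)), ?_, ?_, by simp⟩
    · apply isPath_append hq1
      · rw [Walk.cons_isPath_iff]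
        constructor
        · apply isPath_append hw hr2
          intro z hz hz'
          by_contra hzc
          exact (hwK z hz hzc).2 (by simp [hz'])
        · rw [Walk.mem_support_append_iff]
          rintro (h | h)
          · exact hwx h
          · exact hcx (append_inter hq2 r1.start_mem_support h).symm
      · intro z hz hz'
        simp only [Walk.mem_support_append_iff, Walk.support_cons, List.mem_cons] at hz'
        rcases hz' with h | h | h
        · exact h
        · by_cases hzc : z = c
          · exact append_inter hq hz (hzc ▸ hc)
          · exact absurd (by simp [hz]) (hwK z h hzc).2
        · exact append_inter hq hz (by simp [h])
    · intro z hz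
      simp only [Walk.mem_support_append_iff, Walk.support_cons, List.mem_cons] at hz
      rcases hz with h | rfl | h | h
      · exact hqK z (by simp [h])
      · exact Or.inl hxK
      · exact hwK' z h
      · exact hqK z (by simp [h])

lemma cmp_isComp {a b v : V} (ha : v ≠ a) (hb : v ≠ b) :
    IsCompAt G a b {y | Rch G {z | z ≠ a ∧ z ≠ b} v y} := by
  have hv : v ∈ {z | z ≠ a ∧ z ≠ b} := ⟨ha, hb⟩
  refine ⟨⟨v, Rch.refl hv⟩, fun y hy => Rch.right hy, connected_of_sconn (sconn_rch hv), ?_⟩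
  intro u hu w hw h
  exact Rch.trans hu (Rch.adj (Rch.right hu) hw h)

lemma cmp_mem_heavySet {a b v : V} (ha : v ≠ a) (hb : v ≠ b) (hna : ¬ G.Adj v a)
    (hnb : ¬ G.Adj v b) : {y | Rch G {z | z ≠ a ∧ z ≠ b} v y} ∈ heavySet G a b := by
  have hv : v ∈ {z | z ≠ a ∧ z ≠ b} := ⟨ha, hb⟩
  exact ⟨cmp_isComp ha hb, v, Rch.refl hv, hna, hnb⟩

lemma cmp_ne {S : Set V} {v w : V} (hw : w ∈ S) (h : ¬ Rch G S v w) :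
    {y | Rch G S v y} ≠ {y | Rch G S w y} := by
  intro he
  have : w ∈ {y | Rch G S w y} := Rch.refl hw
  rw [← he] at this
  exact h this

lemma sepPair_of {a b v w : V} (hab : a ≠ b) (hva : v ≠ a) (hvb : v ≠ b) (hwa : w ≠ a)
    (hwb : w ≠ b) (h : ¬ Rch G {z | z ≠ a ∧ z ≠ b} v w) : SepPair G a b := by
  refine ⟨hab, fun hp => h ?_⟩
  exact (rch_iff (S := {z | z ≠ a ∧ z ≠ b}) ⟨hva, hvb⟩ ⟨hwa, hwb⟩).2 (hp _ _)

lemma no_chord (hK4 : ¬ ContainsK4Subdivision G) (hTr : NoTransitiveEdges G)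
    {s t a b x : V} (p1 : G.Walk s a) (e : G.Adj a x)
    (r : G.Walk x b) (p3 : G.Walk b t) (hp : (p1.append ((Walk.cons e r).append p3)).IsPath)
    (hxb : x ≠ b) {Q : Set V} (hQ : SConn G Q) (hs : ∃ c ∈ Q, G.Adj c s)
    (ht : ∃ c ∈ Q, G.Adj c t)
    (hQp : ∀ z ∈ (p1.append ((Walk.cons e r).append p3)).support, z ∉ Q) : ¬ G.Adj a b := by
  intro hadj
  obtain ⟨u, hu⟩ := hQ.1
  have h := sep hK4 p1 e r p3 hp hxb hQ hs ht hQp (K := ∅)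
    (by rw [Set.union_empty]; exact SConn.singleton a) (by simp) (by simp) (by simp)
    ⟨a, Or.inl rfl, b, rfl, hadj⟩ hu
  refine hTr a b (sepPair_of hadj.ne e.ne' hxb ?_ ?_ h) hadj
  · rintro rfl
    exact hQp u (by simp) hu
  · rintro rfl
    exact hQp u (by simp) hu

lemma two_le_length {x y : V} (q : G.Walk x y) (h : x ≠ y) (hn : ¬ G.Adj x y) : 2 ≤ q.length := by
  cases q with
  | nil => exact absurd rfl h
  | cons e r =>
    cases r with
    | nil => exact absurd e hn
    | cons e' r' => simp

lemma comp_subset {D A B : Set V} (hA : IsCCOf G D A) (hB : IsCCOf G D B) {x : V} (hxA : x ∈ A)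
    (hxB : x ∈ B) : A ⊆ B := by
  intro y hy
  by_contra hyB
  obtain ⟨u, hu, w, hw, -, hwA, hadj⟩ :=
    ((sconn_of_connected hA.2.2.1).2 x hxA y hy).exit hxB hyB
  exact hw (hB.2.2.2 u hu w (hA.2.1 hwA) hadj)

lemma comp_adj {s t : V} {C : Set V} (hC : IsCompAt G s t C) (hst : s ≠ t)
    (hbi : ∀ c x y : V, x ≠ c → y ≠ c → Rch G {z | z ≠ c} x y) :
    (∃ c ∈ C, G.Adj c s) ∧ (∃ c ∈ C, G.Adj c t) := by
  obtain ⟨⟨u, hu⟩, hsub, -, hcl⟩ := hC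
  have hu' := hsub hu
  constructor
  · obtain ⟨x, hx, y, hy, -, hyt, hadj⟩ := (hbi t u s hu'.2 hst).exit hu (fun h => (hsub h).1 rfl)
    have : y = s := by
      by_contra hys
      exact hy (hcl x hx y ⟨hys, hyt⟩ hadj)
    exact ⟨x, hx, this ▸ hadj⟩
  · obtain ⟨x, hx, y, hy, -, hys, hadj⟩ :=
      (hbi s u t hu'.1 hst.symm).exit hu (fun h => (hsub h).2 rfl)
    have : y = t := by
      by_contra hyt
      exact hy (hcl x hx y ⟨hys, hyt⟩ hadj)
    exact ⟨x, hx, this ▸ hadj⟩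

lemma half [Fintype V] (G : SimpleGraph V)
    (hBi : Biconnected G) (hSP : ¬ ContainsK4Subdivision G)
    (hTr : NoTransitiveEdges G)
    (h2heavy : ∀ a b : V, SepPair G a b → (heavySet G a b).ncard ≤ 2)
    (s t : V) (hst : SepPair G s t)
    (hmaxheavy : ∀ a b : V, SepPair G a b →
      (heavySet G a b).ncard ≤ (heavySet G s t).ncard)
    (C₁ C₂ : Set V) (hne : C₁ ≠ C₂)
    (hC₁ : IsCompAt G s t C₁) (hC₂ : IsCompAt G s t C₂)
    (hcover : ∀ C : Set V, IsCompAt G s t C → Heavy G s t C → C = C₁ ∨ C = C₂)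
    (p : G.Walk s t) (hp : p.IsPath) (hpC : ∀ x ∈ p.support, x = s ∨ x = t ∨ x ∈ C₁)
    (hmax : ∀ q : G.Walk s t, q.IsPath →
      (∀ x ∈ q.support, x = s ∨ x = t ∨ x ∈ C₁) → q.length ≤ p.length) :
    ∀ v ∈ C₁, v ∉ p.support → ∃ x ∈ p.support, G.Adj v x := by
  intro v hv hvp
  by_contra hcon
  push Not at hcon
  have hbi : ∀ c x y : V, x ≠ c → y ≠ c → Rch G {z | z ≠ c} x y := by
    intro c x y hx hy
    exact (rch_iff (S := {z | z ≠ c}) hx hy).2 ((hBi.2.2 c).preconnected _ _)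
  have hst' : s ≠ t := hst.1
  have hdisj : ∀ z ∈ C₁, z ∉ C₂ := fun z h1 h2 =>
    hne (Set.Subset.antisymm (comp_subset hC₁ hC₂ h1 h2) (comp_subset hC₂ hC₁ h2 h1))
  have hQ : SConn G C₂ := sconn_of_connected hC₂.2.2.1
  obtain ⟨hs, ht⟩ := comp_adj hC₂ hst' hbi
  have hQp : ∀ z ∈ p.support, z ∉ C₂ := by
    intro z hz hz2
    rcases hpC z hz with rfl | rfl | h
    · exact (hC₂.2.1 hz2).1 rfl
    · exact (hC₂.2.1 hz2).2 rfl
    · exact hdisj z h hz2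
  set K : Set V := {y | Rch G {z | z ∈ C₁ ∧ z ∉ p.support} v y} with hKdef
  have hvS : v ∈ {z | z ∈ C₁ ∧ z ∉ p.support} := ⟨hv, hvp⟩
  have hvK : v ∈ K := Rch.refl hvS
  have hKc : SConn G K := sconn_rch hvS
  have hKS : ∀ z ∈ K, z ∈ C₁ ∧ z ∉ p.support := fun z hz => Rch.right (S := {z | z ∈ C₁ ∧ z ∉ p.support}) (x := v) hz
  have hKn0 : ∀ k ∈ K, ∀ y, G.Adj k y → y ∈ K ∨ y ∈ p.support := by
    intro k hk y hky
    by_cases hyp : y ∈ p.support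
    · exact Or.inr hyp
    · left
      have hy1 : y ∈ C₁ := by
        refine hC₁.2.2.2 k (hKS k hk).1 y ⟨?_, ?_⟩ hky
        · rintro rfl
          exact hyp p.start_mem_support
        · rintro rfl
          exact hyp p.end_mem_support
      exact Rch.trans hk (Rch.adj (hKS k hk) ⟨hy1, hyp⟩ hky)
  have hKp : ∀ z ∈ p.support, z ∉ K := fun z hz hzK => (hKS z hzK).2 hz
  have hKQ : ∀ z ∈ K, z ∉ C₂ := fun z hz => hdisj z (hKS z hz).1
  have hvs : v ≠ s := (hC₁.2.1 hv).1
  have hvt : v ≠ t := (hC₁.2.1 hv).2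
  -- first and last attachments
  have hN1 : ∃ x ∈ p.support, x ∈ {y | ∃ k ∈ K, G.Adj k y} := by
    obtain ⟨k, hk, y, hy, -, -, hky⟩ :=
      (hbi t v s hvt hst').exit hvK (hKp s p.start_mem_support)
    exact ⟨y, (hKn0 k hk y hky).resolve_left hy, k, hk, hky⟩
  obtain ⟨a, haN, p1, p', rfl, hfirst⟩ := firstHit p _ hN1
  have hvne : ∀ z ∈ (p1.append p').support, v ≠ z := by
    rintro z hz rfl
    exact hvp hz
  have hN2 : ∃ x ∈ (p1.append p').support, x ≠ a ∧ ∃ k ∈ K, G.Adj k x := by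
    have : ∃ c ∈ (p1.append p').support, c ≠ a := by
      by_cases h : s = a
      · exact ⟨t, Walk.end_mem_support _, fun h' => hst' (h.trans h'.symm)⟩
      · exact ⟨s, Walk.start_mem_support _, h⟩
    obtain ⟨c, hc, hca⟩ := this
    obtain ⟨k, hk, y, hy, -, hya, hky⟩ :=
      (hbi a v c (hvne a (by simp)) hca).exit hvK (hKp c hc)
    exact ⟨y, (hKn0 k hk y hky).resolve_left hy, hya, k, hk, hky⟩
  obtain ⟨w, hwp, hwa, hwN⟩ := hN2
  have hwp' : w ∈ p'.support := by
    rcases (Walk.mem_support_append_iff _ _).1 hwp with h | h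
    · exact absurd (hfirst w h hwN) hwa
    · exact h
  obtain ⟨b, hbN, q1, q2, hq12, hlast0⟩ :=
    firstHit p'.reverse {y | ∃ k ∈ K, G.Adj k y} ⟨w, by simpa using hwp', hwN⟩
  obtain ⟨p2, p3, rfl, hlast⟩ : ∃ (p2 : G.Walk a b) (p3 : G.Walk b t), p' = p2.append p3 ∧
      ∀ z ∈ p3.support, z ∈ {y | ∃ k ∈ K, G.Adj k y} → z = b := by
    refine ⟨q2.reverse, q1.reverse, ?_, ?_⟩
    · rw [← Walk.reverse_append, ← hq12, Walk.reverse_reverse]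
    · intro z hz
      exact hlast0 z (by simpa using hz)
  clear hq12 hlast0 q1 q2
  cases p2 with
  | nil => exact hwa (hlast w (by simpa using hwp') hwN)
  | @cons _ x _ e r =>
  obtain ⟨h1, hr, h3, har, h1r, h13, hr3⟩ := split_facts hp
  have hab : a ≠ b := by
    rintro rfl
    exact har r.end_mem_support
  have hthird := no_third hSP p1 e r p3 hp hQ hs ht hQp hKc hKQ hKp haN hbN
  have hKn : ∀ k ∈ K, ∀ y, G.Adj k y → y ∈ K ∨ y = a ∨ y = b := by
    intro k hk y hky
    rcases hKn0 k hk y hky with h | h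
    · exact Or.inl h
    · right
      simp only [Walk.mem_support_append_iff, Walk.support_cons, List.mem_cons] at h
      rcases h with h | (h | h) | h
      · exact Or.inl (hfirst y h ⟨k, hk, hky⟩)
      · exact Or.inl h
      · by_contra hcon'
        push Not at hcon'
        exact hthird y h hcon'.2 k hk hky
      · exact Or.inr (hlast y h ⟨k, hk, hky⟩)
  have hap : a ∈ (p1.append ((Walk.cons e r).append p3)).support := by simp
  have hbp : b ∈ (p1.append ((Walk.cons e r).append p3)).support := by simp
  have hva := hvne a hap
  have hvb := hvne b hbp
  have hna : ¬ G.Adj v a := hcon a hap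
  have hnb : ¬ G.Adj v b := hcon b hbp
  have hvR : ∀ z, z ∉ K → ¬ Rch G {z | z ≠ a ∧ z ≠ b} v z := by
    intro z hz hR
    obtain ⟨k, hk, y, hy, -, hyab, hky⟩ := hR.exit hvK hz
    rcases hKn k hk y hky with h | h | h
    · exact hy h
    · exact hyab.1 h
    · exact hyab.2 h
  have hQne : ∀ u ∈ C₂, u ≠ a ∧ u ≠ b := by
    intro u hu
    constructor
    · rintro rfl
      exact hQp _ hap hu
    · rintro rfl
      exact hQp _ hbp hu
  have hSep : SepPair G a b := by
    obtain ⟨u, hu⟩ := hQ.1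
    exact sepPair_of hab hva hvb (hQne u hu).1 (hQne u hu).2 (hvR u (fun h => hKQ u h hu))
  -- the subpath between the attachments is long
  have hlen : 3 ≤ r.length := by
    obtain ⟨q, hq, hqK, hvq⟩ := fan hab (hKp a hap) (hKp b hbp) hKc haN hbN hKn hbi hvK
    have hq4 : 4 ≤ q.length := by
      obtain ⟨q1, q2, -, -, rfl⟩ := hq.mem_support_iff_exists_append.1 hvq
      have := two_le_length q1 hva.symm (fun h => hna h.symm)
      have := two_le_length q2 hvb hnb
      rw [Walk.length_append]
      omega
    have hle := hmax (p1.append (q.append p3)) ?_ ?_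
    · simp only [Walk.length_append, Walk.length_cons] at hle
      omega
    · apply isPath_append h1
      · apply isPath_append hq h3
        intro z hz hz'
        rcases hqK z hz with h | h | h
        · exact absurd h (hKp z (by simp [hz']))
        · subst h
          exact absurd hz' (h13 z p1.end_mem_support)
        · exact h
      · intro z hz hz'
        rcases (Walk.mem_support_append_iff _ _).1 hz' with h' | h'
        · rcases hqK z h' with h | h | h
          · exact absurd h (hKp z (by simp [hz]))
          · exact h
          · subst h
            exact absurd p3.start_mem_support (h13 z hz)
        · exact absurd h' (h13 z hz)
    · intro z hz
      simp only [Walk.mem_support_append_iff] at hz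
      rcases hz with h | h | h
      · exact hpC z (by simp [h])
      · rcases hqK z h with h | h | h
        · exact Or.inr (Or.inr (hKS z h).1)
        · exact hpC z (h ▸ hap)
        · exact hpC z (h ▸ hbp)
      · exact hpC z (by simp [h])
  have hsepx : ∀ u ∈ C₂, ¬ Rch G {z | z ≠ a ∧ z ≠ b} x u := by
    intro u hu
    have hxb : x ≠ b := by
      rintro rfl
      rw [(Walk.isPath_iff_nil.1 hr).eq_nil] at hlen
      simp at hlen
    refine sep hSP p1 e r p3 hp hxb hQ hs ht hQp (K := K) ?_ hKQ hKp hKn ?_ hu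
    · obtain ⟨k, hk, hka⟩ := haN
      exact (SConn.singleton a).union hKc ⟨a, rfl, k, hk, hka.symm⟩
    · obtain ⟨k, hk, hkb⟩ := hbN
      exact ⟨k, Or.inr hk, b, rfl, hkb⟩
  obtain ⟨y, hya, hyb, hyna, hynb, hyK, hysep⟩ : ∃ y, y ≠ a ∧ y ≠ b ∧ ¬ G.Adj y a ∧ ¬ G.Adj y b ∧
      y ∉ K ∧ ∀ u ∈ C₂, ¬ Rch G {z | z ≠ a ∧ z ≠ b} y u := by
    cases r with
    | nil => simp at hlen
    | @cons _ y _ e2 r2 =>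
    cases r2 with
    | nil => simp at hlen
    | @cons _ x3 _ e3 r3 =>
    have hr' := hr
    rw [Walk.cons_isPath_iff] at hr'
    have hr2 := hr'.1
    have hxr2 := hr'.2
    rw [Walk.cons_isPath_iff] at hr2
    have hx3b : x3 ≠ b := by
      rintro rfl
      rw [(Walk.isPath_iff_nil.1 hr2.1).eq_nil] at hlen
      simp at hlen
    have hya : y ≠ a := by
      rintro rfl
      exact har (by simp)
    have hyb : y ≠ b := by
      rintro rfl
      exact hr2.2 r3.end_mem_support
    have hxb : x ≠ b := by
      rintro rfl
      exact hxr2 (by simp)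
    refine ⟨y, hya, hyb, ?_, ?_, hKp y (by simp), ?_⟩
    · intro h
      have heq : p1.append ((Walk.cons e (Walk.cons e2 (Walk.cons e3 r3))).append p3) =
        p1.append ((Walk.cons e (Walk.cons e2 Walk.nil)).append ((Walk.cons e3 r3).append p3)) := by
        simp
      rw [heq] at hp hQp
      exact no_chord hSP hTr _ _ _ _ hp e2.ne hQ hs ht hQp h.symm
    · intro h
      have heq : p1.append ((Walk.cons e (Walk.cons e2 (Walk.cons e3 r3))).append p3) =
        (p1.append (Walk.cons e (Walk.cons e2 Walk.nil))).append ((Walk.cons e3 r3).append p3) := by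
        rw [← Walk.append_assoc]
        simp
      rw [heq] at hp hQp
      exact no_chord hSP hTr _ _ _ _ hp hx3b hQ hs ht hQp h
    · intro u hu hR
      exact hsepx u hu (Rch.trans (Rch.adj ⟨e.ne', hxb⟩ ⟨hya, hyb⟩ e2) hR)
  have hv_heavy := cmp_mem_heavySet hva hvb hna hnb
  have hy_heavy := cmp_mem_heavySet hya hyb hyna hynb
  have hvy := cmp_ne (S := {z | z ≠ a ∧ z ≠ b}) ⟨hya, hyb⟩ (hvR y hyK)
  have h2 : 1 < (heavySet G a b).ncard :=
    (Set.one_lt_ncard_iff (Set.toFinite _)).2 ⟨_, _, hv_heavy, hy_heavy, hvy⟩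
  have hC₂h : Heavy G s t C₂ := by
    by_contra hno
    have hsub : heavySet G s t ⊆ {C₁} := by
      rintro C ⟨hC, hCh⟩
      rcases hcover C hC hCh with rfl | rfl
      · rfl
      · exact absurd hCh hno
    have := Set.ncard_le_ncard hsub (Set.toFinite _)
    rw [Set.ncard_singleton] at this
    have := hmaxheavy a b hSep
    omega
  obtain ⟨u, hu, hus, hut⟩ := hC₂h
  have hunp : ∀ z ∈ (p1.append ((Walk.cons e r).append p3)).support, ¬ G.Adj u z := by
    intro z hz hadj
    rcases hpC z hz with rfl | rfl | h
    · exact hus hadj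
    · exact hut hadj
    · exact hdisj z h (hC₂.2.2.2 u hu z (hC₁.2.1 h) hadj)
  have hu_heavy := cmp_mem_heavySet (hQne u hu).1 (hQne u hu).2 (hunp a hap) (hunp b hbp)
  have hvu := cmp_ne (S := {z | z ≠ a ∧ z ≠ b}) (hQne u hu) (hvR u (fun h => hKQ u h hu))
  have hyu := cmp_ne (S := {z | z ≠ a ∧ z ≠ b}) (hQne u hu) (hysep u hu)
  have h3' : 2 < (heavySet G a b).ncard :=
    (Set.two_lt_ncard_iff (Set.toFinite _)).2
      ⟨_, _, _, hv_heavy, hy_heavy, hu_heavy, hvy, hvu, hyu⟩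
  have := h2heavy a b hSep
  omega

end SPAux

/-- In a biconnected series-parallel simple graph without transitive edges that is at
most 2-heavy, take a separation pair `(s, t)` with the maximum number of heavy
components and components `C₁ ≠ C₂` covering all heavy components, with longest
pole-to-pole paths `p₁, p₂` respectively. Then every vertex of `Cᵢ` not on `pᵢ` is
adjacent to a vertex of `pᵢ`. -/
theorem stmt11 [Fintype V] (G : SimpleGraph V)
    (hBi : Biconnected G) (hSP : ¬ ContainsK4Subdivision G)
    (hTr : NoTransitiveEdges G)
    (h2heavy : ∀ a b : V, SepPair G a b → (heavySet G a b).ncard ≤ 2)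
    (s t : V) (hst : SepPair G s t)
    (hmaxheavy : ∀ a b : V, SepPair G a b →
      (heavySet G a b).ncard ≤ (heavySet G s t).ncard)
    (C₁ C₂ : Set V) (hne : C₁ ≠ C₂)
    (hC₁ : IsCompAt G s t C₁) (hC₂ : IsCompAt G s t C₂)
    (hcover : ∀ C : Set V, IsCompAt G s t C → Heavy G s t C → C = C₁ ∨ C = C₂)
    (p₁ p₂ : G.Walk s t)
    (hp₁ : p₁.IsPath) (hp₁C : ∀ x ∈ p₁.support, x = s ∨ x = t ∨ x ∈ C₁)
    (hmax₁ : ∀ q : G.Walk s t, q.IsPath →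
      (∀ x ∈ q.support, x = s ∨ x = t ∨ x ∈ C₁) → q.length ≤ p₁.length)
    (hp₂ : p₂.IsPath) (hp₂C : ∀ x ∈ p₂.support, x = s ∨ x = t ∨ x ∈ C₂)
    (hmax₂ : ∀ q : G.Walk s t, q.IsPath →
      (∀ x ∈ q.support, x = s ∨ x = t ∨ x ∈ C₂) → q.length ≤ p₂.length) :
    (∀ v ∈ C₁, v ∉ p₁.support → ∃ x ∈ p₁.support, G.Adj v x) ∧
    (∀ v ∈ C₂, v ∉ p₂.support → ∃ x ∈ p₂.support, G.Adj v x) := by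
  exact ⟨SPAux.half G hBi hSP hTr h2heavy s t hst hmaxheavy C₁ C₂ hne hC₁ hC₂ hcover p₁ hp₁ hp₁C hmax₁,
    SPAux.half G hBi hSP hTr h2heavy s t hst hmaxheavy C₂ C₁ hne.symm hC₂ hC₁
      (fun C h h' => (hcover C h h').symm) p₂ hp₂ hp₂C hmax₂⟩
end

section
/- Let G be a biconnected series-parallel simple graph with no transitive edges such that G is at most 2-heavy. Let (s,t) be a separation pair of G whose number of heavy components is maximum among all separation pairs of G, and let G₁ and G₂ be two distinct components of G with respect to (s,t) such that every heavy component of G with respect to (s,t) is G₁ or G₂. For i ∈ {1,2}, let p_i be a path from s to t all of whose vertices belong to G_i of maximum length (number of edges) among all such paths. Let C be a connected component of the graph obtained from G_i by deleting the vertices of p_i, and let u and v be the two vertices of p_i that have a neighbor in C. Then (u,v) is a separation pair of G, the vertex set of C is the vertex set of a connected component of G − u − v, and every vertex of C is adjacent in G to u or to v (i.e., the corresponding component of G with respect to (u,v) is light). -/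
open SimpleGraph

variable {V : Type*}

theorem aux_append_isPath {G : SimpleGraph V} {a b c : V} {p : G.Walk a b} {q : G.Walk b c}
    (hp : p.IsPath) (hq : q.IsPath) (h : ∀ x, x ∈ p.support → x ∈ q.support → x = b) :
    (p.append q).IsPath := by
  induction p with
  | nil => simpa using hq
  | cons hadj p ih =>
    rw [Walk.cons_isPath_iff] at hp
    rw [Walk.cons_append, Walk.cons_isPath_iff]
    refine ⟨ih hp.1 hq (fun x hx hx' => h x (by simp [hx]) hx'), ?_⟩
    rw [Walk.mem_support_append_iff]
    rintro (h1 | h1)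
    · exact hp.2 h1
    · have := h _ (by simp) h1
      subst this
      exact hp.2 (by simp)

theorem aux_append_disj {G : SimpleGraph V} {a b c : V} {p : G.Walk a b} {q : G.Walk b c}
    (h : (p.append q).IsPath) (x : V) (hp : x ∈ p.support) (hq : x ∈ q.support) : x = b := by
  by_contra hx
  exact h.ne_of_mem_support_of_append hx hp hq rfl

theorem aux_append_iff {G : SimpleGraph V} {a b c : V} {p : G.Walk a b} {q : G.Walk b c} :
    (p.append q).IsPath ↔
      p.IsPath ∧ q.IsPath ∧ ∀ x, x ∈ p.support → x ∈ q.support → x = b :=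
  ⟨fun h => ⟨h.of_append_left, h.of_append_right, aux_append_disj h⟩,
    fun h => aux_append_isPath h.1 h.2.1 h.2.2⟩

theorem aux_walk_of_conn {G : SimpleGraph V} {S : Set V} (h : (G.induce S).Preconnected)
    {a b : V} (ha : a ∈ S) (hb : b ∈ S) :
    ∃ w : G.Walk a b, w.IsPath ∧ ∀ y ∈ w.support, y ∈ S := by
  classical
  obtain ⟨w⟩ := h ⟨a, ha⟩ ⟨b, hb⟩
  let w' : G.Walk a b := w.map (Embedding.induce S).toHom
  have hw' : ∀ y ∈ w'.support, y ∈ S := by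
    intro y hy
    have hy2 : y ∈ w.support.map (Embedding.induce (G := G) S).toHom := by
      rw [← Walk.support_map]; exact hy
    rw [List.mem_map] at hy2
    obtain ⟨z, -, rfl⟩ := hy2
    exact z.2
  exact ⟨w'.bypass, w'.bypass_isPath, fun y hy => hw' y (w'.support_bypass_subset_support hy)⟩

/-- Two disjoint paths joined by a path avoiding a third one: a subdivision of `K₄`. -/
theorem aux_K4_path {G : SimpleGraph V} {u v : V} (huv : u ≠ v) (P₁ P₂ P₃ : G.Walk u v)
    (h₁ : P₁.IsPath) (h₂ : P₂.IsPath) (h₃ : P₃.IsPath)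
    (h12 : ∀ x ∈ P₁.support, x ∈ P₂.support → x = u ∨ x = v)
    (h13 : ∀ x ∈ P₁.support, x ∈ P₃.support → x = u ∨ x = v)
    (h23 : ∀ x ∈ P₂.support, x ∈ P₃.support → x = u ∨ x = v)
    (n : ℕ) : ∀ (a b : V) (W : G.Walk a b), W.length ≤ n → a ∈ P₁.support → b ∈ P₂.support →
      W.IsPath → (∀ x ∈ W.support, x ∉ P₃.support) → ContainsK4Subdivision G := by
  induction n with
  | zero =>
    intro a b W hl ha hb hW hav
    have : a = b := Walk.eq_of_length_eq_zero (Nat.le_zero.mp hl)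
    subst this
    exfalso
    have := hav a (by simp)
    rcases h12 a ha hb with rfl | rfl <;> simp at this
  | succ n ih =>
    intro a b W hl ha hb hW hav
    by_cases hc1 : ∃ x ∈ W.support, x ≠ a ∧ x ∈ P₁.support
    · obtain ⟨x, hx, hxa, hx1⟩ := hc1
      obtain ⟨A, B, rfl⟩ := Walk.mem_support_iff_exists_append.mp hx
      refine ih x b B ?_ hx1 hb hW.of_append_right (fun y hy => hav y (by simp [hy]))
      have : A.length ≠ 0 := fun h => hxa (Walk.eq_of_length_eq_zero h).symm
      rw [Walk.length_append] at hl
      omega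
    by_cases hc2 : ∃ x ∈ W.support, x ≠ b ∧ x ∈ P₂.support
    · obtain ⟨x, hx, hxa, hx1⟩ := hc2
      obtain ⟨A, B, rfl⟩ := Walk.mem_support_iff_exists_append.mp hx
      refine ih a x A ?_ ha hx1 hW.of_append_left (fun y hy => hav y (by simp [hy]))
      have : B.length ≠ 0 := fun h => hxa (Walk.eq_of_length_eq_zero h)
      rw [Walk.length_append] at hl
      omega
    clear ih
    push Not at hc1 hc2
    have ha3 := hav a (by simp)
    have hb3 := hav b (by simp)
    have hau : a ≠ u := by rintro rfl; simp at ha3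
    have hav' : a ≠ v := by rintro rfl; simp at ha3
    have hbu : b ≠ u := by rintro rfl; simp at hb3
    have hbv : b ≠ v := by rintro rfl; simp at hb3
    have hab : a ≠ b := by
      rintro rfl
      rcases h12 a ha hb with h | h <;> contradiction
    have hu3 : u ∈ P₃.support := by simp
    have hv3 : v ∈ P₃.support := by simp
    obtain ⟨A, A', rfl⟩ := Walk.mem_support_iff_exists_append.mp ha
    obtain ⟨B, B', rfl⟩ := Walk.mem_support_iff_exists_append.mp hb
    rw [aux_append_iff] at h₁ h₂
    simp only [Walk.mem_support_append_iff] at *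
    obtain ⟨hA, hA', hAA⟩ := h₁
    obtain ⟨hB, hB', hBB⟩ := h₂
    have e1 : u ∈ A.support := by simp
    have e2 : v ∈ A'.support := by simp
    have e3 : u ∈ B.support := by simp
    have e4 : v ∈ B'.support := by simp
    have e5 : a ∈ A.support := by simp
    have e6 : a ∈ A'.support := by simp
    have e7 : b ∈ B.support := by simp
    have e8 : b ∈ B'.support := by simp
    have e9 : a ∈ W.support := by simp
    have e10 : b ∈ W.support := by simp
    refine ⟨u, v, a, b, P₃, A, B, A'.reverse, B'.reverse, W, ?_, h₃, hA, hB, hA'.reverse,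
      hB'.reverse, hW, ?_, ?_⟩
    · simp; grind
    · simp only [List.pairwise_cons, List.mem_cons, List.not_mem_nil, or_false,
        Set.disjoint_left, interiorSet, Set.mem_ofPred_eq, Walk.support_reverse, List.mem_reverse,
        forall_eq_or_imp, forall_eq, List.Pairwise.nil, and_true, false_imp_iff, imp_true_iff]
      refine ⟨⟨?_, ?_, ?_, ?_, ?_⟩, ⟨?_, ?_, ?_, ?_⟩, ⟨?_, ?_, ?_⟩, ⟨?_, ?_⟩, ?_⟩ <;> grind
    · simp only [List.mem_cons, List.not_mem_nil, or_false,
        interiorSet, Set.mem_ofPred_eq, Walk.support_reverse, List.mem_reverse,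
        forall_eq_or_imp, forall_eq, Set.mem_insert_iff, Set.mem_singleton_iff]
      refine ⟨?_, ?_, ?_, ?_, ?_, ?_⟩ <;> grind

theorem aux_K4 {G : SimpleGraph V} {u v : V} (huv : u ≠ v) (P₁ P₂ P₃ : G.Walk u v)
    (h₁ : P₁.IsPath) (h₂ : P₂.IsPath) (h₃ : P₃.IsPath)
    (h12 : ∀ x ∈ P₁.support, x ∈ P₂.support → x = u ∨ x = v)
    (h13 : ∀ x ∈ P₁.support, x ∈ P₃.support → x = u ∨ x = v)
    (h23 : ∀ x ∈ P₂.support, x ∈ P₃.support → x = u ∨ x = v)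
    {a b : V} (W : G.Walk a b) (ha : a ∈ P₁.support) (hb : b ∈ P₂.support)
    (hW : ∀ x ∈ W.support, x ∉ P₃.support) : ContainsK4Subdivision G := by
  classical
  exact aux_K4_path huv P₁ P₂ P₃ h₁ h₂ h₃ h12 h13 h23 _ a b W.bypass le_rfl ha hb
    W.bypass_isPath (fun x hx => hW x (W.support_bypass_subset_support hx))

/-- Poles joined by an edge and two more nontrivial paths: impossible. -/
theorem aux_chord {G : SimpleGraph V} (hSP : ¬ ContainsK4Subdivision G)
    (hTr : NoTransitiveEdges G) {u v : V} (P₁ P₂ : G.Walk u v)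
    (h₁ : P₁.IsPath) (h₂ : P₂.IsPath)
    (h12 : ∀ x ∈ P₁.support, x ∈ P₂.support → x = u ∨ x = v)
    {a b : V} (ha : a ∈ P₁.support) (hb : b ∈ P₂.support)
    (hau : a ≠ u) (hav : a ≠ v) (hbu : b ≠ u) (hbv : b ≠ v) : ¬ G.Adj u v := by
  intro hadj
  have hnp : (G.induce {x | x ≠ u ∧ x ≠ v}).Preconnected := by
    by_contra hc
    exact hTr u v ⟨hadj.ne, hc⟩ hadj
  obtain ⟨W, -, hW⟩ := aux_walk_of_conn hnp (a := a) (b := b) ⟨hau, hav⟩ ⟨hbu, hbv⟩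
  refine hSP (aux_K4 hadj.ne P₁ P₂ hadj.toWalk h₁ h₂ ?_ h12 ?_ ?_ W ha hb ?_)
  · simp [Walk.cons_isPath_iff, hadj.ne]
  · simp
  · simp
  · intro x hx
    simpa using hW x hx

/-- On the cycle formed by two internally disjoint paths there is no chord at `u`. -/
theorem aux_no_chord {G : SimpleGraph V} (hSP : ¬ ContainsK4Subdivision G)
    (hTr : NoTransitiveEdges G) {u v x : V} (huv : u ≠ v) (A : G.Walk u x) (B : G.Walk x v)
    (R : G.Walk u v) (hQ : (A.append B).IsPath) (hR : R.IsPath)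
    (hd : ∀ y ∈ (A.append B).support, y ∈ R.support → y = u ∨ y = v)
    (hA : 2 ≤ A.length) (hxv : x ≠ v) : ¬ G.Adj u x := by
  cases A with
  | nil => simp at hA
  | @cons _ w _ hadj A =>
  have hux : u ≠ x := by
    rintro rfl
    have := hQ.of_append_left
    simp [Walk.cons_isPath_iff] at this
  have hwx : w ≠ x := by
    rintro rfl
    have := hQ.of_append_left.of_cons
    rw [Walk.isPath_iff_nil, Walk.nil_iff_length_eq] at this
    simp [this] at hA
  have hwu : w ≠ u := hadj.ne'
  have hQ' := hQ
  rw [aux_append_iff] at hQ'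
  obtain ⟨h1, h2, h3⟩ := hQ'
  refine aux_chord hSP hTr (a := w) (b := v) (Walk.cons hadj A) (R.append B.reverse) h1 ?_ ?_
    (by simp) (by simp) hwu hwx huv.symm hxv.symm
  · rw [aux_append_iff]
    refine ⟨hR, h2.reverse, ?_⟩
    intro y hy hy'
    rw [Walk.support_reverse, List.mem_reverse] at hy'
    rcases hd y (by simp [hy']) hy with h | h
    · subst h
      exact absurd (h3 y (by simp) hy') hux
    · exact h
  · intro y hy hy'
    simp only [Walk.mem_support_append_iff, Walk.support_reverse, List.mem_reverse] at hy' hd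
    rcases hy' with hy' | hy'
    · rcases hd y (Or.inl hy) hy' with h | h
      · exact Or.inl h
      · subst h
        exact Or.inr (h3 y hy (by simp))
    · exact Or.inr (h3 y hy hy')

theorem aux_segment {G : SimpleGraph V} {u v x z : V} (R : G.Walk u v)
    (hx : x ∈ R.support) (hz : z ∈ R.support) :
    (∃ (A : G.Walk u x) (B : G.Walk x z) (C : G.Walk z v), R = A.append (B.append C)) ∨
    (∃ (A : G.Walk u z) (B : G.Walk z x) (C : G.Walk x v), R = A.append (B.append C)) := by
  obtain ⟨A, B, rfl⟩ := Walk.mem_support_iff_exists_append.mp hx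
  rw [Walk.mem_support_append_iff] at hz
  rcases hz with hz | hz
  · right
    obtain ⟨A1, A2, rfl⟩ := Walk.mem_support_iff_exists_append.mp hz
    exact ⟨A1, A2, B, by rw [Walk.append_assoc]⟩
  · left
    obtain ⟨B1, B2, rfl⟩ := Walk.mem_support_iff_exists_append.mp hz
    exact ⟨A, B1, B2, rfl⟩

theorem aux_replace {G : SimpleGraph V} {u v x z : V} (hxz : x ≠ z) {A : G.Walk u x}
    {B W : G.Walk x z} {C : G.Walk z v} (h : (A.append (B.append C)).IsPath) (hW : W.IsPath)
    (hd : ∀ y ∈ W.support, y ∈ (A.append (B.append C)).support → y = x ∨ y = z) :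
    (A.append (W.append C)).IsPath := by
  simp only [aux_append_iff, Walk.mem_support_append_iff] at *
  obtain ⟨hA, ⟨hB, hC, hBC⟩, hABC⟩ := h
  have e1 : z ∈ C.support := by simp
  have e2 : x ∈ A.support := by simp
  have e3 : z ∈ B.support := by simp
  have e4 : x ∈ B.support := by simp
  refine ⟨hA, ⟨hW, hC, ?_⟩, ?_⟩ <;> grind

theorem aux_first_hit {G : SimpleGraph V} (S D : Set V)
    (hcl : ∀ a ∈ D, ∀ b, G.Adj a b → b ∈ D ∨ b ∈ S) {y u : V} (W : G.Walk y u) :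
    u ∈ S → (y ∈ D ∨ y ∈ S) → ∃ z ∈ S, ∃ W' : G.Walk y z,
      (∀ w ∈ W'.support, w ∈ W.support) ∧ (∀ w ∈ W'.support, w ∈ D ∨ w ∈ S) ∧
      (∀ w ∈ W'.support, w ∈ S → w = z) := by
  induction W with
  | nil =>
    intro hu _
    exact ⟨_, hu, Walk.nil, by simp, by simp [hu], by simp⟩
  | @cons a b c hadj W ih =>
    intro hu hy
    by_cases hyS : a ∈ S
    · exact ⟨a, hyS, Walk.nil, by simp, by simp [hyS], by simp⟩
    · have hyD : a ∈ D := hy.resolve_right hyS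
      obtain ⟨z, hz, W', h1, h2, h3⟩ := ih hu (hcl a hyD b hadj)
      refine ⟨z, hz, Walk.cons hadj W', ?_, ?_, ?_⟩
      · intro w hw
        rw [Walk.support_cons, List.mem_cons] at hw ⊢
        exact hw.imp id (h1 w)
      · intro w hw
        rw [Walk.support_cons, List.mem_cons] at hw
        rcases hw with rfl | hw
        · exact Or.inl hyD
        · exact h2 w hw
      · intro w hw hwS
        rw [Walk.support_cons, List.mem_cons] at hw
        rcases hw with rfl | hw
        · exact absurd hwS hyS
        · exact h3 w hw hwS

theorem aux_comp_closed {G : SimpleGraph V} {u v : V} {D : Set V} (hD : IsCompAt G u v D)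
    {a b : V} (ha : a ∈ D) (hab : G.Adj a b) : b ∈ D ∨ b = u ∨ b = v := by
  by_cases h : b = u ∨ b = v
  · exact Or.inr h
  · push Not at h
    exact Or.inl (hD.2.2.2 a ha b h hab)

theorem aux_through_step {G : SimpleGraph V} {u v : V}
    (hconn : ∀ x : V, (G.induce {v | v ≠ x}).Connected) {D : Set V} (hD : IsCompAt G u v D)
    {x y : V} (hx : x ∈ D) (hy : y ∈ D) (hxy : G.Adj x y)
    (hR : ∃ R : G.Walk u v, R.IsPath ∧ x ∈ R.support ∧ ∀ y ∈ R.support, y = u ∨ y = v ∨ y ∈ D) :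
    ∃ R : G.Walk u v, R.IsPath ∧ y ∈ R.support ∧ ∀ y ∈ R.support, y = u ∨ y = v ∨ y ∈ D := by
  classical
  obtain ⟨R, hR, hxR, hRD⟩ := hR
  by_cases hyR : y ∈ R.support
  · exact ⟨R, hR, hyR, hRD⟩
  have hux : u ≠ x := fun h => (hD.2.1 hx).1 h.symm
  obtain ⟨W, -, hW⟩ := aux_walk_of_conn (hconn x).preconnected (a := y) (b := u) hxy.ne' hux
  obtain ⟨z, hz, W', h1, h2, h3⟩ := aux_first_hit {w | w ∈ R.support} D (by
    intro a ha b hab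
    rcases aux_comp_closed hD ha hab with h | rfl | rfl
    · exact Or.inl h
    · right; simp
    · right; simp) W (by simp) (Or.inl hy)
  have hz' : z ∈ R.support := hz
  have hxW : x ∉ W'.bypass.support := fun h =>
    hW x (h1 x (W'.support_bypass_subset_support h)) rfl
  have hxz : x ≠ z := by
    rintro rfl
    exact hxW (by simp)
  let T : G.Walk x z := Walk.cons hxy W'.bypass
  have hT : T.IsPath := by
    rw [Walk.cons_isPath_iff]
    exact ⟨W'.bypass_isPath, hxW⟩
  have hTy : y ∈ T.support := by simp [T]
  have hTR : ∀ w ∈ T.support, w ∈ R.support → w = x ∨ w = z := by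
    intro w hw hwR
    simp only [T, Walk.support_cons, List.mem_cons] at hw
    rcases hw with rfl | hw
    · exact Or.inl rfl
    · exact Or.inr (h3 w (W'.support_bypass_subset_support hw) hwR)
  have hTD : ∀ w ∈ T.support, w = u ∨ w = v ∨ w ∈ D := by
    intro w hw
    simp only [T, Walk.support_cons, List.mem_cons] at hw
    rcases hw with rfl | hw
    · exact Or.inr (Or.inr hx)
    · rcases h2 w (W'.support_bypass_subset_support hw) with h | h
      · exact Or.inr (Or.inr h)
      · exact hRD w h
  rcases aux_segment R hxR hz' with ⟨A, B, C, rfl⟩ | ⟨A, B, C, rfl⟩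
  · refine ⟨A.append (T.append C), aux_replace hxz hR hT hTR, by simp [hTy], ?_⟩
    intro w hw
    simp only [Walk.mem_support_append_iff] at hw hRD
    grind
  · refine ⟨A.append (T.reverse.append C), aux_replace hxz.symm hR hT.reverse ?_, by simp [hTy], ?_⟩
    · intro w hw hw'
      rw [Walk.support_reverse, List.mem_reverse] at hw
      exact (hTR w hw hw').symm
    · intro w hw
      simp only [Walk.mem_support_append_iff, Walk.support_reverse, List.mem_reverse] at hw hRD
      grind

theorem aux_through {G : SimpleGraph V} {u v : V} (huv : u ≠ v)
    (hconn : ∀ x : V, (G.induce {v | v ≠ x}).Connected) {D : Set V} (hD : IsCompAt G u v D)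
    {d e : V} (hd : d ∈ D) (he : e ∈ D) (hud : G.Adj u d) (hve : G.Adj v e) {x : V} (hx : x ∈ D) :
    ∃ R : G.Walk u v, R.IsPath ∧ x ∈ R.support ∧ ∀ y ∈ R.support, y = u ∨ y = v ∨ y ∈ D := by
  have base : ∃ R : G.Walk u v, R.IsPath ∧ d ∈ R.support ∧
      ∀ y ∈ R.support, y = u ∨ y = v ∨ y ∈ D := by
    obtain ⟨W, hW, hWD⟩ := aux_walk_of_conn hD.2.2.1.preconnected hd he
    have hu : u ∉ W.support := fun h => (hD.2.1 (hWD u h)).1 rfl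
    have hv : v ∉ W.support := fun h => (hD.2.1 (hWD v h)).2 rfl
    refine ⟨Walk.cons hud (W.concat hve.symm), ?_, by simp, ?_⟩
    · rw [Walk.cons_isPath_iff, Walk.concat_isPath_iff]
      refine ⟨⟨hW, hv⟩, ?_⟩
      simp [Walk.support_concat, hu, huv]
    · intro y hy
      simp only [Walk.support_cons, Walk.support_concat, List.mem_cons, List.concat_eq_append,
        List.mem_append, List.not_mem_nil, or_false] at hy
      grind
  obtain ⟨W, -, hWD⟩ := aux_walk_of_conn hD.2.2.1.preconnected hd hx
  clear hud
  induction W with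
  | nil => exact base
  | cons hadj W ih =>
    have hb := hWD _ (List.mem_cons_of_mem _ W.start_mem_support)
    exact ih hb hx (aux_through_step hconn hD hd hb hadj base)
      (fun y hy => hWD y (List.mem_cons_of_mem _ hy))

theorem aux_comp_exists (G : SimpleGraph V) {u v a : V} (hu : a ≠ u) (hv : a ≠ v) :
    ∃ B, IsCompAt G u v B ∧ a ∈ B := by
  have haB : ∃ w : G.Walk a a, ∀ y ∈ w.support, y ≠ u ∧ y ≠ v :=
    ⟨Walk.nil, by simp [hu, hv]⟩
  refine ⟨{x | ∃ w : G.Walk a x, ∀ y ∈ w.support, y ≠ u ∧ y ≠ v}, ⟨⟨a, haB⟩, ?_, ?_, ?_⟩, haB⟩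
  · rintro x ⟨w, hw⟩
    exact hw x (by simp)
  · set B : Set V := {x | ∃ w : G.Walk a x, ∀ y ∈ w.support, y ≠ u ∧ y ≠ v} with hB
    have key : ∀ x : B, (G.induce B).Reachable ⟨a, haB⟩ x := by
      rintro ⟨x, w, hw⟩
      refine ⟨w.induce B ?_⟩
      intro y hy
      obtain ⟨A, C, rfl⟩ := Walk.mem_support_iff_exists_append.mp hy
      exact ⟨A, fun z hz => hw z (by simp [hz])⟩
    haveI : Nonempty B := ⟨⟨a, haB⟩⟩
    exact ⟨fun x y => (key x).symm.trans (key y)⟩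
  · rintro x ⟨w, hw⟩ b hb hxb
    refine ⟨w.concat hxb, ?_⟩
    intro y hy
    simp only [Walk.support_concat, List.concat_eq_append, List.mem_append, List.mem_cons,
      List.not_mem_nil, or_false] at hy
    rcases hy with hy | rfl
    · exact hw y hy
    · exact hb

theorem aux_comp_sub {G : SimpleGraph V} {u v b : V} {B D : Set V} (hB : IsCompAt G u v B)
    (hD : IsCompAt G u v D) (hbB : b ∈ B) (hbD : b ∈ D) : B ⊆ D := by
  intro x hx
  obtain ⟨W, -, hW⟩ := aux_walk_of_conn hB.2.2.1.preconnected hbB hx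
  clear hbB hx
  induction W with
  | nil => exact hbD
  | cons hadj W ih =>
    have hb := hW _ (List.mem_cons_of_mem _ W.start_mem_support)
    exact ih (hD.2.2.2 _ hbD _ (hB.2.1 hb) hadj) (fun y hy => hW y (List.mem_cons_of_mem _ hy))

theorem aux_two_le {G : SimpleGraph V} {a b : V} (w : G.Walk a b) (hne : a ≠ b)
    (h : ¬ G.Adj a b) : 2 ≤ w.length := by
  cases w with
  | nil => exact absurd rfl hne
  | cons hadj w =>
    cases w with
    | nil => exact absurd hadj h
    | cons _ _ => simp

theorem aux_split_two {G : SimpleGraph V} {a b : V} (w : G.Walk a b) (h : 2 ≤ w.length) :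
    ∃ (c : V) (A : G.Walk a c) (B : G.Walk c b), w = A.append B ∧ A.length = 2 := by
  cases w with
  | nil => simp at h
  | cons h1 w =>
    cases w with
    | nil => simp at h
    | cons h2 w => exact ⟨_, Walk.cons h1 (Walk.cons h2 Walk.nil), w, by simp, by simp⟩

theorem aux_light [Fintype V] {G : SimpleGraph V}
    (hconn : ∀ x : V, (G.induce {v | v ≠ x}).Connected) (hSP : ¬ ContainsK4Subdivision G)
    (hTr : NoTransitiveEdges G) {s t u v : V} {C C' D : Set V} (huv : u ≠ v)
    (hC : IsCompAt G s t C) (hC' : IsCompAt G s t C') (hdisj : ∀ x ∈ C, x ∉ C')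
    (hD : IsCompAt G u v D) (hDC : D ⊆ C)
    {d e : V} (hd : d ∈ D) (he : e ∈ D) (hud : G.Adj u d) (hve : G.Adj v e)
    (A : G.Walk s u) (Q : G.Walk u v) (B : G.Walk v t) (hp : (A.append (Q.append B)).IsPath)
    (hpC : ∀ x ∈ (A.append (Q.append B)).support, x = s ∨ x = t ∨ x ∈ C)
    (hpD : ∀ x ∈ (A.append (Q.append B)).support, x ∉ D)
    (hmax : ∀ q : G.Walk s t, q.IsPath → (∀ x ∈ q.support, x = s ∨ x = t ∨ x ∈ C) →
      q.length ≤ (A.append (Q.append B)).length)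
    (p' : G.Walk s t) (hp' : p'.IsPath) (hp'C : ∀ x ∈ p'.support, x = s ∨ x = t ∨ x ∈ C')
    {z : V} (hz : z ∈ p'.support) (hzC : z ∈ C')
    (hheavy : 2 ≤ (heavySet G u v).ncard → Heavy G s t C')
    (h2 : (heavySet G u v).ncard ≤ 2) :
    ∀ x ∈ D, G.Adj x u ∨ G.Adj x v := by
  classical
  intro x hx
  by_contra hxn
  push Not at hxn
  have hDu : ∀ w ∈ D, w ≠ u ∧ w ≠ v := fun w hw => hD.2.1 hw
  have hCs : ∀ w ∈ C, w ≠ s ∧ w ≠ t := fun w hw => hC.2.1 hw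
  have hCs' : ∀ w ∈ C', w ≠ s ∧ w ≠ t := fun w hw => hC'.2.1 hw
  have hst : s ≠ t := by
    rintro rfl
    have := (Walk.isPath_iff_nil.mp hp)
    rw [Walk.nil_iff_length_eq] at this
    simp only [Walk.length_append] at this
    have : Q.length = 0 := by omega
    exact huv (Walk.eq_of_length_eq_zero this)
  obtain ⟨R, hR, hxR, hRD⟩ := aux_through huv hconn hD hd he hud hve hx
  have hRp : ∀ y ∈ R.support, y ∈ (A.append (Q.append B)).support → y = u ∨ y = v := by
    intro y hy hy'
    have := hpD y hy'
    have := hRD y hy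
    tauto
  -- the new path is no longer
  have hRQ : R.length ≤ Q.length := by
    have := hmax (A.append (R.append B)) (aux_replace huv hp hR hRp) (by
      intro y hy
      simp only [Walk.mem_support_append_iff] at hy hpC
      rcases hy with hy | hy | hy
      · exact hpC y (Or.inl hy)
      · rcases hRD y hy with rfl | rfl | h
        · exact hpC y (Or.inl (by simp))
        · exact hpC y (Or.inr (Or.inr (by simp)))
        · exact Or.inr (Or.inr (hDC h))
      · exact hpC y (Or.inr (Or.inr hy)))
    simp only [Walk.length_append] at this
    omega
  have hR4 : 4 ≤ R.length := by
    obtain ⟨X, Y, rfl⟩ := Walk.mem_support_iff_exists_append.mp hxR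
    have h1 := aux_two_le X (hDu x hx).1.symm (fun h => hxn.1 h.symm)
    have h2 := aux_two_le Y (hDu x hx).2 hxn.2
    rw [Walk.length_append]
    omega
  have hQpath : Q.IsPath := hp.of_append_right.of_append_left
  have hQR : ∀ y ∈ Q.support, y ∈ R.support → y = u ∨ y = v :=
    fun y hy hy' => hRp y hy' (by simp [hy])
  obtain ⟨a, Q₁, Q₂, hQeq, hQ₁⟩ := aux_split_two Q (by omega)
  have hQ₂ : 2 ≤ Q₂.length := by
    rw [hQeq, Walk.length_append] at hRQ
    omega
  have haQ : a ∈ Q.support := by rw [hQeq]; simp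
  have hau : a ≠ u := by
    rintro rfl
    rw [hQeq] at hQpath
    have := Walk.isPath_iff_nil.mp hQpath.of_append_left
    rw [Walk.nil_iff_length_eq] at this
    omega
  have hav : a ≠ v := by
    rintro rfl
    rw [hQeq] at hQpath
    have := Walk.isPath_iff_nil.mp hQpath.of_append_right
    rw [Walk.nil_iff_length_eq] at this
    omega
  have hnau : ¬ G.Adj u a :=
    aux_no_chord hSP hTr huv Q₁ Q₂ R (hQeq ▸ hQpath) hR (hQeq ▸ hQR) hQ₁.ge hav
  have hnav : ¬ G.Adj v a := by
    refine aux_no_chord hSP hTr huv.symm Q₂.reverse Q₁.reverse R.reverse ?_ hR.reverse ?_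
      (by simpa using hQ₂) hau
    · rw [← Walk.reverse_append, ← hQeq]
      exact hQpath.reverse
    · rw [← Walk.reverse_append, ← hQeq]
      intro y hy hy'
      rw [Walk.support_reverse, List.mem_reverse] at hy hy'
      exact (hQR y hy hy').symm
  have haD : a ∉ D := hpD a (by simp [haQ])
  obtain ⟨E, hE, haE⟩ := aux_comp_exists G hau hav
  have hDE : D ≠ E := by rintro rfl; exact haD haE
  have hDheavy : D ∈ heavySet G u v := ⟨hD, x, hx, hxn⟩
  have hEheavy : E ∈ heavySet G u v :=
    ⟨hE, a, haE, fun h => hnau h.symm, fun h => hnav h.symm⟩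
  have hfin : (heavySet G u v).Finite := Set.toFinite _
  obtain ⟨y, hyC, hys, hyt⟩ := hheavy (by
    rw [← Set.ncard_pair hDE]
    exact Set.ncard_le_ncard (by
      rintro F (rfl | rfl)
      · exact hDheavy
      · exact hEheavy) hfin)
  -- vertices of the first path versus `C'`
  have hpole : ∀ w ∈ (A.append (Q.append B)).support, w ∉ C' ∧ ¬ G.Adj y w := by
    intro w hw
    rcases hpC w hw with rfl | rfl | h
    · exact ⟨fun h => (hCs' _ h).1 rfl, hys⟩
    · exact ⟨fun h => (hCs' _ h).2 rfl, hyt⟩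
    · refine ⟨hdisj w h, fun hadj => hdisj w h ?_⟩
      exact hC'.2.2.2 y hyC w (hC.2.1 h) hadj
  obtain ⟨huC, hyu⟩ := hpole u (by simp)
  obtain ⟨hvC, hyv⟩ := hpole v (by simp)
  obtain ⟨F, hF, hyF⟩ := aux_comp_exists G (u := u) (v := v) (a := y)
    (fun h => huC (h ▸ hyC)) (fun h => hvC (h ▸ hyC))
  have hFheavy : F ∈ heavySet G u v := ⟨hF, y, hyF, hyu, hyv⟩
  have hDF : D ≠ F := by
    rintro rfl
    exact hdisj y (hDC hyF) hyC
  have hEF : E ≠ F := by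
    rintro rfl
    obtain ⟨W₁, -, hW₁⟩ := aux_walk_of_conn hE.2.2.1.preconnected haE hyF
    obtain ⟨W₂, -, hW₂⟩ := aux_walk_of_conn hC'.2.2.1.preconnected hyC hzC
    have hp2 := hp
    simp only [aux_append_iff, Walk.mem_support_append_iff] at hp2
    simp only [Walk.mem_support_append_iff] at hpC hRp hpole
    obtain ⟨hA, ⟨-, hB, hQB⟩, hAQB⟩ := hp2
    have e1 : t ∈ B.support := by simp
    have e2 : s ∈ A.support := by simp
    have e3 : v ∈ B.support := by simp
    have e4 : u ∈ A.support := by simp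
    have e5 : u ∈ Q.support := by simp
    have e6 : v ∈ Q.support := by simp
    refine hSP (aux_K4 huv Q (A.reverse.append (p'.append B.reverse)) R hQpath ?_ hR ?_ hQR ?_
      (W₁.append W₂) haQ (by simp [hz]) ?_)
    · simp only [aux_append_iff, Walk.mem_support_append_iff, Walk.support_reverse,
        List.mem_reverse]
      refine ⟨hA.reverse, ⟨hp', hB.reverse, ?_⟩, ?_⟩
      · intro w hw hw'
        rcases hp'C w hw with rfl | rfl | h
        · have := hAQB w e2 (Or.inr hw')
          subst this
          exact absurd (hQB w e5 hw') huv
        · rfl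
        · exact absurd h (hpole w (Or.inr (Or.inr hw'))).1
      · rintro w hw (hw' | hw')
        · rcases hp'C w hw' with rfl | rfl | h
          · rfl
          · have := hAQB w hw (Or.inr e1)
            subst this
            exact absurd (hQB w e5 e1) huv
          · exact absurd h (hpole w (Or.inl hw)).1
        · have := hAQB w hw (Or.inr hw')
          subst this
          exact absurd (hQB w e5 hw') huv
    · intro w hw hw'
      simp only [Walk.mem_support_append_iff, Walk.support_reverse, List.mem_reverse] at hw'
      rcases hw' with hw' | hw' | hw'
      · exact Or.inl (hAQB w hw' (Or.inl hw))
      · rcases hp'C w hw' with rfl | rfl | h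
        · exact Or.inl (hAQB w e2 (Or.inl hw))
        · exact Or.inr (hQB w hw e1)
        · exact absurd h (hpole w (Or.inr (Or.inl hw))).1
      · exact Or.inr (hQB w hw hw')
    · intro w hw hw'
      simp only [Walk.mem_support_append_iff, Walk.support_reverse, List.mem_reverse] at hw
      rcases hw with hw | hw | hw
      · exact hRp w hw' (Or.inl hw)
      · rcases hRD w hw' with h | h | h
        · exact Or.inl h
        · exact Or.inr h
        · have hwC := hDC h
          rcases hp'C w hw with h' | h' | h'
          · exact absurd h' (hCs w hwC).1
          · exact absurd h' (hCs w hwC).2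
          · exact absurd h' (hdisj w hwC)
      · exact hRp w hw' (Or.inr (Or.inr hw))
    · intro w hw hw'
      rw [Walk.mem_support_append_iff] at hw
      rcases hw with hw | hw
      · have hwE := hW₁ w hw
        rcases hRD w hw' with h | h | h
        · exact (hE.2.1 hwE).1 h
        · exact (hE.2.1 hwE).2 h
        · exact haD (aux_comp_sub hE hD hwE h haE)
      · have hwC := hW₂ w hw
        rcases hRD w hw' with rfl | rfl | h
        · exact huC hwC
        · exact hvC hwC
        · exact hdisj w (hDC h) hwC
  have h3 : ({D, E, F} : Set (Set V)).ncard = 3 :=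
    Set.ncard_eq_three.mpr ⟨D, E, F, hDE, hDF, hEF, rfl⟩
  have h4 := Set.ncard_le_ncard (s := ({D, E, F} : Set (Set V))) (t := heavySet G u v) (by
      rintro K (rfl | rfl | rfl)
      · exact hDheavy
      · exact hEheavy
      · exact hFheavy) hfin
  omega

theorem aux_core [Fintype V] (G : SimpleGraph V)
    (hBi : Biconnected G) (hSP : ¬ ContainsK4Subdivision G)
    (hTr : NoTransitiveEdges G)
    (h2heavy : ∀ a b : V, SepPair G a b → (heavySet G a b).ncard ≤ 2)
    (s t : V) (hst : SepPair G s t)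
    (hmaxheavy : ∀ a b : V, SepPair G a b →
      (heavySet G a b).ncard ≤ (heavySet G s t).ncard)
    (C C' : Set V) (hne : C ≠ C')
    (hC : IsCompAt G s t C) (hC' : IsCompAt G s t C')
    (hcover : ∀ K : Set V, IsCompAt G s t K → Heavy G s t K → K = C ∨ K = C')
    (p p' : G.Walk s t)
    (hp : p.IsPath) (hpC : ∀ x ∈ p.support, x = s ∨ x = t ∨ x ∈ C)
    (hmax : ∀ q : G.Walk s t, q.IsPath →
      (∀ x ∈ q.support, x = s ∨ x = t ∨ x ∈ C) → q.length ≤ p.length)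
    (hp' : p'.IsPath) (hp'C : ∀ x ∈ p'.support, x = s ∨ x = t ∨ x ∈ C')
    (D : Set V)
    (hD : IsCCOf G ((C ∪ {s, t}) \ {x | x ∈ p.support}) D)
    (u v : V) (huvne : u ≠ v)
    (hA : {x | x ∈ p.support ∧ ∃ y ∈ D, G.Adj x y} = {u, v}) :
    SepPair G u v ∧ IsCompAt G u v D ∧ ∀ x ∈ D, G.Adj x u ∨ G.Adj x v := by
  have hu : u ∈ {x | x ∈ p.support ∧ ∃ y ∈ D, G.Adj x y} := by rw [hA]; simp
  have hv : v ∈ {x | x ∈ p.support ∧ ∃ y ∈ D, G.Adj x y} := by rw [hA]; simp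
  obtain ⟨hup, d, hd, hud⟩ := hu
  obtain ⟨hvp, e, he, hve⟩ := hv
  have hdisj : ∀ x ∈ C, x ∉ C' := fun x hx hx' =>
    hne ((aux_comp_sub hC hC' hx hx').antisymm (aux_comp_sub hC' hC hx' hx))
  have hpD : ∀ x ∈ p.support, x ∉ D := fun x hx hxD => (hD.2.1 hxD).2 hx
  have hDC : D ⊆ C := by
    intro x hx
    rcases (hD.2.1 hx).1 with h | rfl | rfl
    · exact h
    · exact absurd hx (hpD _ (by simp))
    · exact absurd hx (hpD _ (by simp))
  have hDcomp : IsCompAt G u v D := by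
    refine ⟨hD.1, ?_, hD.2.2.1, ?_⟩
    · intro x hx
      refine ⟨?_, ?_⟩
      · rintro rfl; exact hpD _ hup hx
      · rintro rfl; exact hpD _ hvp hx
    · intro x hx w hw hxw
      by_cases hwp : w ∈ p.support
      · have : w ∈ ({u, v} : Set V) := by
          rw [← hA]; exact ⟨hwp, x, hx, hxw.symm⟩
        rcases this with h | h
        · exact absurd h hw.1
        · exact absurd h hw.2
      · refine hD.2.2.2 x hx w ⟨?_, hwp⟩ hxw
        rcases aux_comp_closed hC (hDC hx) hxw with h | h | h
        · exact Or.inl h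
        · exact Or.inr (Or.inl h)
        · exact Or.inr (Or.inr h)
  have hpole : ∀ w ∈ p.support, w ∉ C' := by
    intro w hw hwC
    rcases hpC w hw with h | h | h
    · exact (hC'.2.1 hwC).1 h
    · exact (hC'.2.1 hwC).2 h
    · exact hdisj w h hwC
  have hsep : SepPair G u v := by
    refine ⟨huvne, fun hpre => ?_⟩
    obtain ⟨z, hz⟩ := hC'.1
    have hzuv : z ∈ {x | x ≠ u ∧ x ≠ v} :=
      ⟨fun h => hpole u hup (h ▸ hz), fun h => hpole v hvp (h ▸ hz)⟩
    have hall : IsCompAt G u v {x | x ≠ u ∧ x ≠ v} :=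
      ⟨⟨z, hzuv⟩, subset_rfl, by
        haveI : Nonempty {x | x ≠ u ∧ x ≠ v} := ⟨⟨z, hzuv⟩⟩
        exact ⟨hpre⟩, fun _ _ w hw _ => hw⟩
    exact hdisj z (hDC (aux_comp_sub hall hDcomp (hDcomp.2.1 hd) hd hzuv)) hz
  refine ⟨hsep, hDcomp, ?_⟩
  obtain ⟨z, hz, hzC⟩ : ∃ z ∈ p'.support, z ∈ C' := by
    have hnadj := hTr s t hst
    clear hmax
    cases p' with
    | nil => exact absurd rfl hst.1
    | @cons _ w _ hadj q =>
      refine ⟨w, by simp, ?_⟩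
      rcases hp'C w (by simp) with rfl | rfl | h
      · exact absurd hadj G.irrefl
      · exact absurd hadj hnadj
      · exact h
  have hheavy : 2 ≤ (heavySet G u v).ncard → Heavy G s t C' := by
    intro h2
    by_contra hnh
    have hsub : heavySet G s t ⊆ {C} := by
      rintro K ⟨hK, hKh⟩
      rcases hcover K hK hKh with rfl | rfl
      · rfl
      · exact absurd hKh hnh
    have h1 := Set.ncard_le_ncard hsub (Set.toFinite _)
    rw [Set.ncard_singleton] at h1
    have := hmaxheavy u v hsep
    omega
  rcases aux_segment p hup hvp with ⟨A, Q, B, rfl⟩ | ⟨A, Q, B, rfl⟩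
  · exact aux_light hBi.2.2 hSP hTr huvne hC hC' hdisj hDcomp hDC hd he hud hve A Q B hp hpC hpD
      hmax p' hp' hp'C hz hzC hheavy (h2heavy u v hsep)
  · have hsymm : ∀ K, IsCompAt G u v K ↔ IsCompAt G v u K := by
      intro K
      have : {x | x ≠ u ∧ x ≠ v} = {x | x ≠ v ∧ x ≠ u} := by ext x; exact and_comm
      unfold IsCompAt
      rw [this]
    have hheq : heavySet G v u = heavySet G u v := by
      ext K
      refine and_congr (hsymm K).symm ?_
      unfold Heavy
      simp only [and_comm]
    intro x hx
    exact (aux_light hBi.2.2 hSP hTr huvne.symm hC hC' hdisj ((hsymm D).mp hDcomp) hDC he hd hve hud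
      A Q B hp hpC hpD hmax p' hp' hp'C hz hzC (hheq ▸ hheavy) (hheq ▸ h2heavy u v hsep) x hx).symm

/-- In a biconnected series-parallel simple graph without transitive edges that is at
most 2-heavy, take a separation pair `(s, t)` with the maximum number of heavy
components and components `C₁ ≠ C₂` covering all heavy components, with longest
pole-to-pole paths `p₁, p₂` respectively. Let `D` be a connected component of `Cᵢ`
(for `i ∈ {1,2}`) minus the vertices of `pᵢ`, and let `u ≠ v` be the two vertices of
`pᵢ` having a neighbor in `D`. Then `(u, v)` is a separation pair of `G`, `D` is the
vertex set of a connected component of `G - u - v`, and every vertex of `D` is adjacent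
to `u` or to `v` (the component is light). -/
theorem stmt12 [Fintype V] (G : SimpleGraph V)
    (hBi : Biconnected G) (hSP : ¬ ContainsK4Subdivision G)
    (hTr : NoTransitiveEdges G)
    (h2heavy : ∀ a b : V, SepPair G a b → (heavySet G a b).ncard ≤ 2)
    (s t : V) (hst : SepPair G s t)
    (hmaxheavy : ∀ a b : V, SepPair G a b →
      (heavySet G a b).ncard ≤ (heavySet G s t).ncard)
    (C₁ C₂ : Set V) (hne : C₁ ≠ C₂)
    (hC₁ : IsCompAt G s t C₁) (hC₂ : IsCompAt G s t C₂)
    (hcover : ∀ C : Set V, IsCompAt G s t C → Heavy G s t C → C = C₁ ∨ C = C₂)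
    (p₁ p₂ : G.Walk s t)
    (hp₁ : p₁.IsPath) (hp₁C : ∀ x ∈ p₁.support, x = s ∨ x = t ∨ x ∈ C₁)
    (hmax₁ : ∀ q : G.Walk s t, q.IsPath →
      (∀ x ∈ q.support, x = s ∨ x = t ∨ x ∈ C₁) → q.length ≤ p₁.length)
    (hp₂ : p₂.IsPath) (hp₂C : ∀ x ∈ p₂.support, x = s ∨ x = t ∨ x ∈ C₂)
    (hmax₂ : ∀ q : G.Walk s t, q.IsPath →
      (∀ x ∈ q.support, x = s ∨ x = t ∨ x ∈ C₂) → q.length ≤ p₂.length)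
    (Ci : Set V) (pi : G.Walk s t)
    (hi : (Ci = C₁ ∧ pi = p₁) ∨ (Ci = C₂ ∧ pi = p₂))
    (D : Set V)
    (hD : IsCCOf G ((Ci ∪ {s, t}) \ {x | x ∈ pi.support}) D)
    (u v : V) (huvne : u ≠ v)
    (hA : {x | x ∈ pi.support ∧ ∃ y ∈ D, G.Adj x y} = {u, v}) :
    SepPair G u v ∧ IsCompAt G u v D ∧ ∀ x ∈ D, G.Adj x u ∨ G.Adj x v := by
  rcases hi with ⟨rfl, rfl⟩ | ⟨rfl, rfl⟩
  · exact aux_core G hBi hSP hTr h2heavy s t hst hmaxheavy Ci C₂ hne hC₁ hC₂ hcover pi p₂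
      hp₁ hp₁C hmax₁ hp₂ hp₂C D hD u v huvne hA
  · exact aux_core G hBi hSP hTr h2heavy s t hst hmaxheavy Ci C₁ hne.symm hC₂ hC₁
      (fun K h h' => (hcover K h h').symm) pi p₁
      hp₂ hp₂C hmax₂ hp₁ hp₁C D hD u v huvne hA
end

section
/- Let G be a biconnected series-parallel simple graph with no transitive edges, let (s,t) be a separation pair of G, let G₁ and G₂ be two distinct components of G with respect to (s,t), and for i ∈ {1,2} let p_i be a path from s to t all of whose vertices belong to G_i of maximum length (number of edges) among all such paths. Then the concatenation of p₁ with the reverse of p₂ is a cycle of G, and this cycle is an induced cycle of G, i.e., two vertices of the cycle are adjacent in G if and only if they are consecutive on the cycle. -/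
open SimpleGraph

variable {V : Type*}

/-- A walk between distinct vertices not using the edge joining them has an internal vertex. -/
lemma exists_interior {G : SimpleGraph V} {x y : V} (p : G.Walk x y) (hxy : x ≠ y)
    (he : s(x, y) ∉ p.edges) : ∃ u ∈ p.support, u ≠ x ∧ u ≠ y := by
  cases p with
  | nil => exact absurd rfl hxy
  | @cons _ v _ h p =>
    refine ⟨v, by simp, h.ne', ?_⟩
    rintro rfl
    simp at he

/-- A shortest connection between the interiors of two paths avoiding the endpoints. -/
lemma exists_link {G : SimpleGraph V} {x y : V} (A B : Set V) (n : ℕ) :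
    ∀ (u v : V) (Q : G.Walk u v), Q.length = n → u ∈ A → v ∈ B →
      (∀ z ∈ Q.support, z ≠ x ∧ z ≠ y) →
      ∃ (a b : V) (R : G.Walk a b), R.IsPath ∧ a ∈ A ∧ b ∈ B ∧
        (∀ z ∈ R.support, z ≠ x ∧ z ≠ y) ∧
        ∀ z ∈ R.support, z ≠ a → z ≠ b → z ∉ A ∧ z ∉ B := by
  classical
  induction n using Nat.strong_induction_on with
  | _ n ih =>
    intro u v Q hn hu hv hQ
    by_cases h : ∃ z ∈ Q.support, z ≠ u ∧ z ≠ v ∧ (z ∈ A ∨ z ∈ B)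
    · obtain ⟨z, hz, hzu, hzv, hz' | hz'⟩ := h
      · exact ih _ (hn ▸ Walk.length_dropUntil_lt_length hz hzu) z v (Q.dropUntil z hz) rfl hz' hv
          fun w hw => hQ w (Q.support_dropUntil_subset_support hz hw)
      · exact ih _ (hn ▸ Walk.length_takeUntil_lt_length hz hzv) u z (Q.takeUntil z hz) rfl hu hz'
          fun w hw => hQ w (Q.support_takeUntil_subset_support hz hw)
    · push Not at h
      exact ⟨u, v, Q.bypass, Q.bypass_isPath, hu, hv,
        fun z hz => hQ z (Q.support_bypass_subset_support hz),
        fun z hz h1 h2 => h z (Q.support_bypass_subset_support hz) h1 h2⟩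

/-- The two halves of a path at a vertex meet only there. -/
lemma take_drop_meet [DecidableEq V] {G : SimpleGraph V} {x y a : V} {p : G.Walk x y}
    (hp : p.IsPath) (ha : a ∈ p.support) {z : V} (h1 : z ∈ (p.takeUntil a ha).support)
    (h2 : z ∈ (p.dropUntil a ha).support) : z = a := by
  by_contra hz
  have := hp
  rw [← p.take_spec ha] at this
  exact this.ne_of_mem_support_of_append hz h1 h2 rfl

lemma path_start_drop [DecidableEq V] {G : SimpleGraph V} {x y a : V} {p : G.Walk x y}
    (hp : p.IsPath) (ha : a ∈ p.support) (hax : a ≠ x) : x ∉ (p.dropUntil a ha).support :=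
  fun h => hax (take_drop_meet hp ha (Walk.start_mem_support _) h).symm

lemma path_end_take [DecidableEq V] {G : SimpleGraph V} {x y a : V} {p : G.Walk x y}
    (hp : p.IsPath) (ha : a ∈ p.support) (hay : a ≠ y) : y ∉ (p.takeUntil a ha).support :=
  fun h => hay (take_drop_meet hp ha h (Walk.end_mem_support _)).symm

/-- Two internally disjoint paths with the same ends, an edge joining the ends, and a
connection between the interiors yield a subdivision of `K₄`. -/
lemma k4_of_chord {G : SimpleGraph V} {x y : V} (hadj : G.Adj x y) (A B : G.Walk x y)
    (hA : A.IsPath) (hB : B.IsPath)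
    (hAB : ∀ z ∈ A.support, z ∈ B.support → z = x ∨ z = y)
    (hAe : s(x, y) ∉ A.edges) (hBe : s(x, y) ∉ B.edges)
    (hc : (G.induce {v | v ≠ x ∧ v ≠ y}).Preconnected) : ContainsK4Subdivision G := by
  classical
  obtain ⟨u, huA, hu⟩ := exists_interior A hadj.ne hAe
  obtain ⟨v, hvB, hv⟩ := exists_interior B hadj.ne hBe
  obtain ⟨W⟩ := hc ⟨u, hu⟩ ⟨v, hv⟩
  have hW : ∀ z ∈ (W.map (Embedding.induce _).toHom).support, z ≠ x ∧ z ≠ y := by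
    intro z hz
    rw [Walk.support_map, List.mem_map] at hz
    obtain ⟨w, -, rfl⟩ := hz
    exact w.2
  obtain ⟨a, b, R, hR, ha, hb, hRxy, hRi⟩ :=
    exists_link {z | z ∈ A.support} {z | z ∈ B.support} _ _ _ _ rfl huA hvB hW
  simp only [Set.mem_ofPred_eq] at ha hb hRi
  have hax := hRxy a R.start_mem_support
  have hbx := hRxy b R.end_mem_support
  have hab : a ≠ b := by
    rintro rfl
    rcases hAB a ha hb with h | h
    · exact hax.1 h
    · exact hax.2 h
  have hxy := hadj.ne
  have A1 := path_start_drop hA ha hax.1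
  have A2 := path_end_take hA ha hax.2
  have B1 := path_start_drop hB hb hbx.1
  have B2 := path_end_take hB hb hbx.2
  have A3 : ∀ z, z ∈ (A.takeUntil a ha).support → z ∈ A.support :=
    fun z h => A.support_takeUntil_subset_support ha h
  have A4 : ∀ z, z ∈ (A.dropUntil a ha).support → z ∈ A.support :=
    fun z h => A.support_dropUntil_subset_support ha h
  have B3 : ∀ z, z ∈ (B.takeUntil b hb).support → z ∈ B.support :=
    fun z h => B.support_takeUntil_subset_support hb h
  have B4 : ∀ z, z ∈ (B.dropUntil b hb).support → z ∈ B.support :=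
    fun z h => B.support_dropUntil_subset_support hb h
  have A5 : ∀ z, z ∈ (A.takeUntil a ha).support → z ∈ (A.dropUntil a ha).support → z = a :=
    fun z => take_drop_meet hA ha
  have B5 : ∀ z, z ∈ (B.takeUntil b hb).support → z ∈ (B.dropUntil b hb).support → z = b :=
    fun z => take_drop_meet hB hb
  have haB : a ∉ B.support := fun h => by
    rcases hAB a ha h with h | h
    · exact hax.1 h
    · exact hax.2 h
  have hbA : b ∉ A.support := fun h => by
    rcases hAB b h hb with h | h
    · exact hbx.1 h
    · exact hbx.2 h
  refine ⟨x, y, a, b, hadj.toWalk, A.takeUntil a ha, B.takeUntil b hb,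
    (A.dropUntil a ha).reverse, (B.dropUntil b hb).reverse, R, ?_, ?_, hA.takeUntil ha,
    hB.takeUntil hb, (hA.dropUntil ha).reverse, (hB.dropUntil hb).reverse, hR, ?_, ?_⟩
  · simp [hxy, hab, hax.1.symm, hax.2.symm, hbx.1.symm, hbx.2.symm]
  · simp [hxy]
  · simp only [List.pairwise_cons, List.mem_cons, List.not_mem_nil, or_false, forall_eq_or_imp,
      forall_eq, interiorSet, Set.disjoint_left, Set.mem_ofPred_eq, Walk.support_reverse,
      List.mem_reverse, Walk.support_cons, Walk.support_nil]
    clear hW W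
    and_intros <;> first | grind | simp
  · simp only [List.mem_cons, List.not_mem_nil, or_false, forall_eq_or_imp,
      forall_eq, interiorSet, Set.mem_ofPred_eq, Walk.support_reverse, Set.mem_insert_iff,
      Set.mem_singleton_iff,
      List.mem_reverse, Walk.support_cons, Walk.support_nil]
    clear hW W
    and_intros <;> first | grind | simp

/-- Without subdivided `K₄` and transitive edges, every cycle is induced. -/
lemma cycle_induced {G : SimpleGraph V} (hSP : ¬ ContainsK4Subdivision G)
    (hTr : NoTransitiveEdges G) {r : V} (c : G.Walk r r) (hc : c.IsCycle) {x y : V}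
    (hx : x ∈ c.support) (hy : y ∈ c.support) (hadj : G.Adj x y) : s(x, y) ∈ c.edges := by
  classical
  by_contra he
  have hpre : (G.induce {v | v ≠ x ∧ v ≠ y}).Preconnected := by
    by_contra h
    exact hTr x y ⟨hadj.ne, h⟩ hadj
  have hc' := hc.rotate hx
  have hy' : y ∈ (c.rotate x hx).support := (c.mem_support_rotate_iff x hx).2 hy
  have he' : s(x, y) ∉ (c.rotate x hx).edges :=
    fun h => he ((c.rotate_edges x hx).perm.mem_iff.1 h)
  generalize c.rotate x hx = d at hc' hy' he'
  have hspec := d.take_spec hy'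
  have hcyc := hc'
  rw [← hspec] at hcyc
  have hD : (d.dropUntil y hy').IsPath :=
    hcyc.isPath_of_append_right (Walk.not_nil_of_ne hadj.ne)
  have hnd := hcyc.support_nodup
  rw [Walk.tail_support_append, List.nodup_append'] at hnd
  refine hSP (k4_of_chord hadj (d.takeUntil y hy') (d.dropUntil y hy').reverse
    (hc'.isPath_takeUntil hy') hD.reverse ?_ ?_ ?_ hpre)
  · intro z h1 h2
    rw [Walk.support_reverse, List.mem_reverse] at h2
    rw [Walk.mem_support_iff] at h1 h2
    rcases h1 with h1 | h1
    · exact .inl h1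
    rcases h2 with h2 | h2
    · exact .inr h2
    · exact (hnd.2.2 h1 h2).elim
  · exact fun h => he' (d.edges_takeUntil_subset_edges hy' h)
  · rw [Walk.edges_reverse, List.mem_reverse]
    exact fun h => he' (d.edges_dropUntil_subset_edges hy' h)

lemma cc_subset {G : SimpleGraph V} {D C C' : Set V} (h : IsCCOf G D C) (h' : IsCCOf G D C')
    {z : V} (hz : z ∈ C) (hz' : z ∈ C') : C ⊆ C' := by
  intro w hw
  obtain ⟨W⟩ := h.2.2.1.preconnected ⟨z, hz⟩ ⟨w, hw⟩
  have key : ∀ (a b : C) (_ : (G.induce C).Walk a b), (a : V) ∈ C' → (b : V) ∈ C' := by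
    intro a b W
    induction W with
    | nil => exact id
    | @cons a b c hab p ih => exact fun ha => ih (h'.2.2.2 a ha b (h.2.1 b.2) hab)
  exact key _ _ W hz'

/-- In a biconnected series-parallel simple graph without transitive edges, the
concatenation of a longest `s`-`t` path in one component w.r.t. a separation pair
`(s, t)` with the reverse of a longest `s`-`t` path in another component is an induced
cycle of `G`: two of its vertices are adjacent iff they are consecutive on it. -/
theorem stmt13 [Fintype V] (G : SimpleGraph V)
    (hBi : Biconnected G) (hSP : ¬ ContainsK4Subdivision G)
    (hTr : NoTransitiveEdges G)
    (s t : V) (hst : SepPair G s t)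
    (C₁ C₂ : Set V) (hne : C₁ ≠ C₂)
    (hC₁ : IsCompAt G s t C₁) (hC₂ : IsCompAt G s t C₂)
    (p₁ p₂ : G.Walk s t)
    (hp₁ : p₁.IsPath) (hp₁C : ∀ x ∈ p₁.support, x = s ∨ x = t ∨ x ∈ C₁)
    (hmax₁ : ∀ q : G.Walk s t, q.IsPath →
      (∀ x ∈ q.support, x = s ∨ x = t ∨ x ∈ C₁) → q.length ≤ p₁.length)
    (hp₂ : p₂.IsPath) (hp₂C : ∀ x ∈ p₂.support, x = s ∨ x = t ∨ x ∈ C₂)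
    (hmax₂ : ∀ q : G.Walk s t, q.IsPath →
      (∀ x ∈ q.support, x = s ∨ x = t ∨ x ∈ C₂) → q.length ≤ p₂.length) :
    (p₁.append p₂.reverse).IsCycle ∧
    ∀ x ∈ (p₁.append p₂.reverse).support, ∀ y ∈ (p₁.append p₂.reverse).support,
      (G.Adj x y ↔ s(x, y) ∈ (p₁.append p₂.reverse).edges) := by
  have hnadj := hTr s t hst
  have hdisj : ∀ z, z ∈ C₁ → z ∉ C₂ := fun z h1 h2 =>
    hne ((cc_subset hC₁ hC₂ h1 h2).antisymm (cc_subset hC₂ hC₁ h2 h1))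
  have hcyc : (p₁.append p₂.reverse).IsCycle := by
    refine hp₁.isCycle_append hp₂.reverse ?_ ?_
    · rw [Walk.support_reverse]
      intro z h1 h2
      have hs1 := hp₁.support_nodup
      have hs2 := hp₂.reverse.support_nodup
      rw [Walk.support_reverse] at hs2
      have e1 : p₁.support = s :: p₁.support.tail := (Walk.cons_tail_support p₁).symm
      have e2 : p₂.support.reverse = t :: p₂.support.reverse.tail := by
        rw [← Walk.support_reverse]
        exact (Walk.cons_tail_support p₂.reverse).symm
      have hzs : z ≠ s := by
        rintro rfl
        rw [e1] at hs1
        exact (List.nodup_cons.1 hs1).1 h1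
      have hzt : z ≠ t := by
        rintro rfl
        rw [e2] at hs2
        exact (List.nodup_cons.1 hs2).1 h2
      have m1 := hp₁C z (List.mem_of_mem_tail h1)
      have m2 := hp₂C z (List.mem_reverse.1 (List.mem_of_mem_tail h2))
      exact hdisj z (by tauto) (by tauto)
    · left
      by_contra hlen
      have h0 : p₁.length ≠ 0 := fun h => hst.1 (Walk.eq_of_length_eq_zero h)
      exact hnadj (Walk.adj_of_length_eq_one (p := p₁) (by omega))
  refine ⟨hcyc, fun x hx y hy => ⟨cycle_induced hSP hTr _ hcyc hx hy, fun h => ?_⟩⟩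
  exact Walk.adj_of_mem_edges _ h
end

section
/- Let G be a simple graph, let (s,t) be a separation pair of G, and let p be a path from s to t in G. Then all internal vertices of p lie in a single connected component of G − s − t; consequently, the maximum length (number of edges) of a path from s to t in G equals the maximum, over all components G' of G with respect to (s,t), of the maximum length of a path from s to t all of whose vertices belong to G'. -/
open SimpleGraph

variable {V : Type*}

/-- The connected component of `x` inside the subgraph induced by `D`. -/
def compOf (G : SimpleGraph V) (D : Set V) (x : V) : Set V :=
  {v | ∃ w : G.Walk x v, ∀ y ∈ w.support, y ∈ D}

theorem compOf_isCC (G : SimpleGraph V) (D : Set V) (x : V) (hx : x ∈ D) :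
    IsCCOf G D (compOf G D x) := by
  classical
  have hxx : x ∈ compOf G D x := ⟨Walk.nil, by simpa using hx⟩
  refine ⟨⟨x, hxx⟩, ?_, ?_, ?_⟩
  · rintro v ⟨w, hw⟩
    exact hw v w.end_mem_support
  · refine induce_connected_of_patches x hxx ?_
    rintro v ⟨w, hw⟩
    refine ⟨{y | y ∈ w.support}, ?_, w.start_mem_support, w.end_mem_support, ?_⟩
    · intro y hy
      exact ⟨w.takeUntil y hy, fun z hz => hw z (w.support_takeUntil_subset hy hz)⟩
    · exact w.connected_induce_support.preconnected _ _
  · rintro u ⟨w, hw⟩ v hv huv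
    refine ⟨w.concat huv, fun y hy => ?_⟩
    rw [Walk.support_concat] at hy
    simp only [List.concat_eq_append, List.mem_append, List.mem_singleton] at hy
    rcases hy with hy | rfl
    · exact hw y hy
    · exact hv

theorem path_single_comp (G : SimpleGraph V) (s t : V) (hst : SepPair G s t)
    (p : G.Walk s t) (hp : p.IsPath) :
    ∃ C : Set V, IsCompAt G s t C ∧ ∀ x ∈ p.support, x ≠ s → x ≠ t → x ∈ C := by
  classical
  cases p with
  | nil => exact absurd rfl hst.1
  | @cons _ a _ h q =>
    rw [Walk.cons_isPath_iff] at hp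
    obtain ⟨hq, hs⟩ := hp
    by_cases hat : a = t
    · subst hat
      have hD : ∃ x, x ≠ s ∧ x ≠ a := by
        by_contra hne
        exact hst.2 (fun u _ => absurd ⟨u.1, u.2⟩ hne)
      obtain ⟨x, hx⟩ := hD
      refine ⟨_, compOf_isCC G _ x hx, ?_⟩
      rw [Walk.isPath_iff_eq_nil] at hq
      subst hq
      intro y hy h1 h2
      simp at hy
      tauto
    · have has : a ≠ s := h.ne'
      refine ⟨_, compOf_isCC G _ a ⟨has, hat⟩, ?_⟩
      intro x hx h1 h2
      rw [Walk.support_cons, List.mem_cons] at hx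
      have hx' := hx.resolve_left h1
      refine ⟨q.takeUntil x hx', fun y hy => ⟨?_, ?_⟩⟩
      · rintro rfl
        exact hs (q.support_takeUntil_subset hx' hy)
      · rintro rfl
        exact Walk.endpoint_notMem_support_takeUntil hq hx' h2.symm hy

/-- For a separation pair `(s, t)` of a simple graph `G`, the internal vertices of any
`s`-`t` path lie in a single connected component of `G - s - t`; consequently the
maximum length of an `s`-`t` path in `G` equals the maximum over all components `C`
w.r.t. `(s, t)` of the maximum length of an `s`-`t` path with all vertices in the
component. -/
theorem stmt14 [Fintype V] (G : SimpleGraph V)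
    (s t : V) (hst : SepPair G s t)
    (p : G.Walk s t) (hp : p.IsPath) :
    (∃ C : Set V, IsCompAt G s t C ∧ ∀ x ∈ p.support, x ≠ s → x ≠ t → x ∈ C) ∧
    sSup {n : ℕ | ∃ q : G.Walk s t, q.IsPath ∧ q.length = n} =
      sSup {n : ℕ | ∃ C : Set V, IsCompAt G s t C ∧
        ∃ q : G.Walk s t, q.IsPath ∧
          (∀ x ∈ q.support, x = s ∨ x = t ∨ x ∈ C) ∧ q.length = n} := by
  refine ⟨path_single_comp G s t hst p hp, ?_⟩
  congr 1
  ext n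
  constructor
  · rintro ⟨q, hq, rfl⟩
    obtain ⟨C, hC, h⟩ := path_single_comp G s t hst q hq
    refine ⟨C, hC, q, hq, fun x hx => ?_, rfl⟩
    by_cases h1 : x = s
    · exact Or.inl h1
    by_cases h2 : x = t
    · exact Or.inr (Or.inl h2)
    exact Or.inr (Or.inr (h x hx h1 h2))
  · rintro ⟨C, hC, q, hq, _, rfl⟩
    exact ⟨q, hq, rfl⟩
end

section
/- Let G be a simple graph, let c be a cut vertex of G, and let s and t be vertices lying in different connected components of G − c. Then every path from s to t in G passes through c, and the maximum length (number of edges) of a path from s to t in G equals the maximum length of a path from s to c in G plus the maximum length of a path from c to t in G. -/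
open SimpleGraph

variable {V : Type*}

/-- `c` is a cut vertex of `G`: deleting `c` increases the number of connected
components. -/
def IsCutVertex (G : SimpleGraph V) (c : V) : Prop :=
  Nat.card G.ConnectedComponent <
    Nat.card (G.induce {v | v ≠ c}).ConnectedComponent

/-- If `c` is a cut vertex of a simple graph `G` and `s`, `t` lie in different connected
components of `G - c` (and some `s`-`t` path exists), then every `s`-`t` path passes
through `c`, and the maximum length of an `s`-`t` path equals the maximum length of an
`s`-`c` path plus the maximum length of a `c`-`t` path. -/
theorem stmt15 [Fintype V] (G : SimpleGraph V) (c : V) (hc : IsCutVertex G c)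
    (s t : V) (hs : s ≠ c) (ht : t ≠ c)
    (hsep : ¬ (G.induce {v | v ≠ c}).Reachable ⟨s, hs⟩ ⟨t, ht⟩)
    (hex : ∃ p : G.Walk s t, p.IsPath) :
    (∀ p : G.Walk s t, p.IsPath → c ∈ p.support) ∧
    sSup {n : ℕ | ∃ p : G.Walk s t, p.IsPath ∧ p.length = n} =
      sSup {n : ℕ | ∃ p : G.Walk s c, p.IsPath ∧ p.length = n} +
      sSup {n : ℕ | ∃ p : G.Walk c t, p.IsPath ∧ p.length = n} := by
  classical
  have key : ∀ p : G.Walk s t, c ∈ p.support := by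
    intro p
    by_contra hcp
    exact hsep ⟨p.induce {v | v ≠ c} (fun x hx hxc => hcp (hxc ▸ hx))⟩
  have happ : ∀ (p : G.Walk s c) (q : G.Walk c t), p.IsPath → q.IsPath →
      (p.append q).IsPath := by
    intro p q hp hq
    have hqn := hq.support_nodup
    rw [Walk.support_eq_cons, List.nodup_cons] at hqn
    rw [Walk.isPath_def, Walk.support_append, List.nodup_append]
    refine ⟨hp.support_nodup, hqn.2, ?_⟩
    rintro x hx y hy rfl
    have hxc : c ≠ x := by
      rintro rfl
      exact hqn.1 hy
    have hxq : x ∈ q.reverse.support := by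
      rw [Walk.support_reverse, List.mem_reverse]
      exact List.mem_of_mem_tail hy
    have h1 := Walk.endpoint_notMem_support_takeUntil hp hx hxc
    have h2 := Walk.endpoint_notMem_support_takeUntil hq.reverse hxq hxc
    have h3 := key ((p.takeUntil x hx).append (q.reverse.takeUntil x hxq).reverse)
    rw [Walk.mem_support_append_iff, Walk.support_reverse, List.mem_reverse] at h3
    exact h3.elim h1 h2
  have hbdd : ∀ u v : V, BddAbove {n : ℕ | ∃ p : G.Walk u v, p.IsPath ∧ p.length = n} := by
    intro u v
    refine ⟨Fintype.card V, ?_⟩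
    rintro n ⟨p, hp, rfl⟩
    exact hp.length_lt.le
  refine ⟨fun p _ => key p, ?_⟩
  obtain ⟨p₀, hp₀⟩ := hex
  apply le_antisymm
  · refine csSup_le ⟨_, p₀, hp₀, rfl⟩ ?_
    rintro n ⟨p, hp, rfl⟩
    have hl : (p.takeUntil c (key p)).length + (p.dropUntil c (key p)).length = p.length := by
      rw [← Walk.length_append, Walk.take_spec]
    rw [← hl]
    exact add_le_add (le_csSup (hbdd s c) ⟨_, hp.takeUntil (key p), rfl⟩)
      (le_csSup (hbdd c t) ⟨_, hp.dropUntil (key p), rfl⟩)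
  · obtain ⟨p, hp, hpl⟩ := Nat.sSup_mem (s := {n : ℕ | ∃ p : G.Walk s c, p.IsPath ∧ p.length = n})
      ⟨_, _, hp₀.takeUntil (key p₀), rfl⟩ (hbdd s c)
    obtain ⟨q, hq, hql⟩ := Nat.sSup_mem (s := {n : ℕ | ∃ p : G.Walk c t, p.IsPath ∧ p.length = n})
      ⟨_, _, hp₀.dropUntil (key p₀), rfl⟩ (hbdd c t)
    rw [← hpl, ← hql, ← Walk.length_append]
    exact le_csSup (hbdd s t) ⟨_, happ p q hp hq, rfl⟩
end
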